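/- Let p be an odd prime satisfying Vandiver's conjecture (p does not divide the class number h⁺ of ℚ(ζ + ζ⁻¹)), ζ a fixed primitive p-th root of unity in an algebraic closure Q̄ of ℚ, K = ℚ(ζ), and L ⊆ Q̄ the splitting field over K of f_p(x) = 1 − (1 − x^p)^p. Then the map Φ = κ(ζ) × ∏_{i=1}^{(p−1)/2} κ(1 − ζ^{−i}) : Gal(L/K) → (ℤ/pℤ)^{(p+1)/2}, sending σ to the tuple (κ(ζ)(σ), κ(1−ζ^{−1})(σ), …, κ(1−ζ^{−(p−1)/2})(σ)), is a group isomorphism. -/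

import Mathlib

section helpers
open Filter Topology Finset
set_option linter.unusedSectionVars false

/-- Difference bound for `i ^ (-s)`. -/
lemma rpow_diff_bound (s : ℝ) (h1 : 1 ≤ s) (h2 : s ≤ 2) (i : ℕ) (hi : 1 ≤ i) :
    |(i : ℝ) ^ (-s) - ((i + 1 : ℕ) : ℝ) ^ (-s)| ≤ 2 / (i : ℝ) ^ 2 := by
  have hi0 : (1 : ℝ) ≤ i := by exact_mod_cast hi
  have hip : (0 : ℝ) < i := by linarith
  have hA : (i : ℝ) ^ (-s) ≤ 1 / i := by
    rw [one_div, ← Real.rpow_neg_one]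
    exact Real.rpow_le_rpow_of_exponent_le hi0 (by linarith)
  have hr : ((i + 1 : ℕ) : ℝ) ^ (-s) = (i : ℝ) ^ (-s) * ((i : ℝ) / (i + 1)) ^ s := by
    rw [Real.div_rpow hip.le (by positivity), Real.rpow_neg hip.le, Real.rpow_neg (by positivity)]
    have : (i : ℝ) ^ s ≠ 0 := (Real.rpow_pos_of_pos hip s).ne'
    push_cast
    field_simp
  have hB : ((i : ℝ) / (i + 1)) ^ 2 ≤ ((i : ℝ) / (i + 1)) ^ s := by
    rw [← Real.rpow_natCast]
    apply Real.rpow_le_rpow_of_exponent_ge (by positivity)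
    · rw [div_le_one (by positivity)]; linarith
    · exact_mod_cast h2
  have hB' : ((i : ℝ) / (i + 1)) ^ s ≤ 1 := by
    apply Real.rpow_le_one (by positivity)
    · rw [div_le_one (by positivity)]; linarith
    · linarith
  have hpos : 0 ≤ (i : ℝ) ^ (-s) := by positivity
  rw [hr, show (i : ℝ) ^ (-s) - (i : ℝ) ^ (-s) * ((i : ℝ) / (i + 1)) ^ s
      = (i : ℝ) ^ (-s) * (1 - ((i : ℝ) / (i + 1)) ^ s) by ring,
    abs_of_nonneg (mul_nonneg hpos (by linarith))]
  calc (i : ℝ) ^ (-s) * (1 - ((i : ℝ) / (i + 1)) ^ s)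
      ≤ (1 / i) * (1 - ((i : ℝ) / (i + 1)) ^ 2) := by
        apply mul_le_mul hA (by linarith) (by linarith) (by positivity)
    _ ≤ 2 / (i : ℝ) ^ 2 := by
        rw [div_pow, one_sub_div (by positivity), div_mul_div_comm,
          div_le_div_iff₀ (by positivity) (by positivity)]
        nlinarith [pow_pos hip 3, pow_pos hip 2]

lemma tendsto_LSeries_one_of_bounded (f : ℕ → ℂ) (C : ℝ) (f0 : f 0 = 0)
    (hC : ∀ n, ‖∑ i ∈ range n, f i‖ ≤ C) :
    ∃ Λ : ℂ, Tendsto (fun s : ℝ ↦ LSeries f s) (𝓝[>] 1) (𝓝 Λ) ∧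
      Tendsto (fun N ↦ ∑ i ∈ range N, f i / i) atTop (𝓝 Λ) := by
  have hC0 : 0 ≤ C := (norm_nonneg _).trans (hC 0)
  set w : ℝ → ℕ → ℝ := fun s i ↦ (i : ℝ) ^ (-s) with hw
  set G : ℕ → ℂ := fun n ↦ ∑ i ∈ range n, f i with hG
  set D : ℝ → ℕ → ℂ := fun s i ↦ ((w s i - w s (i + 1) : ℝ) : ℂ) * G (i + 1) with hD
  have hDb : ∀ s : ℝ, 1 ≤ s → s ≤ 2 → ∀ i, ‖D s i‖ ≤ 2 / (i : ℝ) ^ 2 * C := by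
    intro s h1 h2 i
    rcases Nat.eq_zero_or_pos i with rfl | hi
    · simp [hD, hG, f0]
    · simp only [hD, norm_mul, Complex.norm_real, Real.norm_eq_abs]
      exact mul_le_mul (rpow_diff_bound s h1 h2 i hi) (hC _) (norm_nonneg _) (by positivity)
  have hsum : Summable fun i : ℕ ↦ 2 / (i : ℝ) ^ 2 * C := by
    apply Summable.mul_right
    have := (Real.summable_one_div_nat_pow (p := 2)).2 (by norm_num)
    simpa [div_eq_mul_inv] using this.mul_left 2
  have hparts : ∀ s : ℝ, ∀ N : ℕ, ∑ i ∈ range (N + 1), ((w s i : ℝ) : ℂ) * f i =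
      ((w s N : ℝ) : ℂ) * G (N + 1) + ∑ i ∈ range N, D s i := by
    intro s N
    induction N with
    | zero => simp [hG]
    | succ N ih =>
      rw [sum_range_succ, ih, sum_range_succ _ N]
      have : f (N + 1) = G (N + 1 + 1) - G (N + 1) := by simp [hG, sum_range_succ]
      rw [this]
      simp only [hD]
      push_cast
      ring
  have hlim : ∀ s : ℝ, 1 ≤ s → s ≤ 2 →
      Tendsto (fun N ↦ ∑ i ∈ range N, ((w s i : ℝ) : ℂ) * f i) atTop (𝓝 (∑' i, D s i)) := by
    intro s h1 h2
    rw [← tendsto_add_atTop_iff_nat 1]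
    simp_rw [hparts]
    have hw0 : Tendsto (fun N : ℕ ↦ w s N * C) atTop (𝓝 0) := by
      have := (tendsto_rpow_neg_atTop (show 0 < s by linarith)).comp tendsto_natCast_atTop_atTop
      simpa using this.mul_const C
    have h0 : Tendsto (fun N ↦ ((w s N : ℝ) : ℂ) * G (N + 1)) atTop (𝓝 0) := by
      apply squeeze_zero_norm _ hw0
      intro N
      have hwn : 0 ≤ w s N := by simp only [hw]; positivity
      rw [norm_mul, Complex.norm_real, Real.norm_eq_abs, abs_of_nonneg hwn]
      exact mul_le_mul_of_nonneg_left (hC _) hwn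
    have hs : Summable (D s) := Summable.of_norm_bounded hsum (hDb s h1 h2)
    simpa using h0.add hs.hasSum.tendsto_sum_nat
  refine ⟨∑' i, D 1 i, ?_, ?_⟩
  · have hT : Tendsto (fun s : ℝ ↦ ∑' i, D s i) (𝓝[>] 1) (𝓝 (∑' i, D 1 i)) := by
      apply tendsto_tsum_of_dominated_convergence hsum
      · intro i
        rcases Nat.eq_zero_or_pos i with rfl | hi
        · simp [hD, hG, f0]
        apply Tendsto.mono_left _ nhdsWithin_le_nhds
        apply Tendsto.mul_const
        have hc : Continuous fun s : ℝ ↦ ((w s i - w s (i + 1) : ℝ) : ℂ) := by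
          simp only [hw]
          apply Complex.continuous_ofReal.comp
          apply Continuous.sub
          · exact Continuous.rpow continuous_const continuous_neg
              (fun _ ↦ Or.inl (by positivity))
          · exact Continuous.rpow continuous_const continuous_neg
              (fun _ ↦ Or.inl (by positivity))
        exact hc.tendsto 1
      · have : Set.Ioc (1 : ℝ) 2 ∈ 𝓝[>] (1 : ℝ) := Ioc_mem_nhdsGT (by norm_num)
        filter_upwards [this] with s hs i using hDb s hs.1.le hs.2 i
    refine hT.congr' ?_
    have : Set.Ioc (1 : ℝ) 2 ∈ 𝓝[>] (1 : ℝ) := Ioc_mem_nhdsGT (by norm_num)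
    filter_upwards [this] with s hs
    have hterm : ∀ i, LSeries.term f s i = ((w s i : ℝ) : ℂ) * f i := by
      intro i
      rcases Nat.eq_zero_or_pos i with rfl | hi
      · simp [f0]
      · rw [LSeries.term_of_ne_zero (by omega), hw, div_eq_mul_inv, mul_comm]
        congr 1
        rw [← Complex.cpow_neg, Complex.ofReal_cpow (by positivity)]
        simp
    have hb : ∀ n, ‖f n‖ ≤ 2 * C := by
      intro n
      have : f n = G (n + 1) - G n := by simp [hG, sum_range_succ]
      rw [this]
      refine (norm_sub_le _ _).trans ?_
      have := hC (n + 1); have := hC n; simp only [hG]; linarith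
    have hsumm : LSeriesSummable f s :=
      LSeriesSummable_of_bounded_of_one_lt_re (m := 2 * C) (fun n _ ↦ hb n) (by simpa using hs.1)
    have h1 := (hsumm.hasSum).tendsto_sum_nat
    simp_rw [hterm] at h1
    have := tendsto_nhds_unique (hlim s hs.1.le hs.2) h1
    rw [this]
    unfold LSeries
    simp_rw [hterm]
  · refine (hlim 1 le_rfl (by norm_num)).congr ?_
    intro N
    apply sum_congr rfl
    intro i _
    simp only [hw]
    rw [Real.rpow_neg_one]
    push_cast
    rw [div_eq_mul_inv, mul_comm]

lemma norm_sum_range_char_le (p : ℕ) [NeZero p] (χ : DirichletCharacter ℂ p) (hχ : χ ≠ 1) (n : ℕ) :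
    ‖∑ i ∈ range n, χ (i : ZMod p)‖ ≤ p := by
  have hz : ∑ i ∈ range p, χ (i : ZMod p) = 0 := by
    rw [← MulChar.sum_eq_zero_of_ne_one hχ]
    refine (Finset.sum_bij' (fun a _ ↦ (a : ZMod p)) (fun a _ ↦ a.val) ?_ ?_ ?_ ?_ ?_)
    · simp
    · intro a _; simpa using ZMod.val_lt a
    · intro a ha; exact ZMod.val_cast_of_lt (by simpa using ha)
    · intro a _; simp
    · simp
  induction n using Nat.strong_induction_on with
  | _ n ih =>
    by_cases hn : n < p
    · refine (norm_sum_le _ _).trans ?_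
      refine (Finset.sum_le_sum (fun i _ ↦ χ.norm_le_one _)).trans ?_
      simp; exact hn.le
    · obtain ⟨m, rfl⟩ := Nat.exists_eq_add_of_le (not_lt.mp hn)
      rw [Finset.sum_range_add, hz, zero_add]
      simpa using ih m (by have := NeZero.pos p; omega)

lemma LFunction_one_gauss (p : ℕ) [Fact p.Prime] (χ : DirichletCharacter ℂ p) (hχ : χ ≠ 1)
    (heven : χ.Even) :
    gaussSum χ⁻¹ (ZMod.stdAddChar (N := p)) * DirichletCharacter.LFunction χ 1 =
      -∑ j : ZMod p, χ⁻¹ j * (Real.log ‖1 - ZMod.stdAddChar j‖ : ℝ) := by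
  set e : AddChar (ZMod p) ℂ := ZMod.stdAddChar (N := p) with he
  have hpp : p.Prime := Fact.out
  have hc0 : ∀ θ : DirichletCharacter ℂ p, θ 0 = 0 := fun θ ↦ MulChar.map_nonunit _ (by simp)
  have f0 : χ ((0 : ℕ) : ZMod p) = 0 := by simp [hc0]
  obtain ⟨Λ, h1, h2⟩ := tendsto_LSeries_one_of_bounded (fun n : ℕ ↦ χ (n : ZMod p)) p f0
    (norm_sum_range_char_le p χ hχ)
  -- Λ is the L-value
  have hΛ : DirichletCharacter.LFunction χ 1 = Λ := by
    have hc : Tendsto (fun s : ℝ ↦ DirichletCharacter.LFunction χ s) (𝓝[>] 1)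
        (𝓝 (DirichletCharacter.LFunction χ 1)) := by
      have := ((DirichletCharacter.differentiable_LFunction hχ).continuous.comp
        Complex.continuous_ofReal).tendsto 1
      simpa [Function.comp_def] using this.mono_left nhdsWithin_le_nhds
    refine tendsto_nhds_unique hc (h1.congr' ?_)
    filter_upwards [self_mem_nhdsWithin] with s hs
    exact (DirichletCharacter.LFunction_eq_LSeries χ (by simpa using hs)).symm
  have hnorm : ∀ j : ZMod p, ‖e j‖ = 1 := fun j ↦ e.norm_apply j
  have hne : ∀ j : ZMod p, j ≠ 0 → e j ≠ 1 := by
    intro j hj h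
    apply hj
    apply ZMod.injective_stdAddChar (N := p)
    simpa using h
  have hchar : ∀ n : ℕ, gaussSum χ⁻¹ e * χ (n : ZMod p) =
      ∑ j : ZMod p, χ⁻¹ j * (e j) ^ n := by
    intro n
    have hg : gaussSum χ⁻¹ (e.mulShift (n : ZMod p)) = χ (n : ZMod p) * gaussSum χ⁻¹ e := by
      by_cases hn : (n : ZMod p) = 0
      · rw [hn]
        simp [hc0, gaussSum, MulChar.sum_eq_zero_of_ne_one (inv_ne_one.mpr hχ)]
      · have := gaussSum_mulShift_eq χ⁻¹ e (Units.mk0 _ hn)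
        simpa using this
    rw [mul_comm, ← hg, gaussSum]
    apply Finset.sum_congr rfl
    intro j _
    rw [AddChar.mulShift_apply, ← AddChar.map_nsmul_eq_pow, nsmul_eq_mul]
  have hab := Complex.tendsto_tsum_powerSeries_nhdsWithin_lt h2
  rw [tendsto_map'_iff] at hab
  have hab' : Tendsto (fun x : ℝ ↦ gaussSum χ⁻¹ e *
      ∑' n : ℕ, χ (n : ZMod p) / n * (x : ℂ) ^ n) (𝓝[<] 1) (𝓝 (gaussSum χ⁻¹ e * Λ)) :=
    hab.const_mul _
  have hlog : Tendsto (fun x : ℝ ↦ ∑ j : ZMod p, χ⁻¹ j * (-Complex.log (1 - x * e j)))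
      (𝓝[<] 1) (𝓝 (∑ j : ZMod p, χ⁻¹ j * (-Complex.log (1 - e j)))) := by
    apply tendsto_finsetSum
    intro j _
    by_cases hj : j = 0
    · subst hj; simp [hc0]
    apply Tendsto.const_mul
    apply Tendsto.neg
    apply Tendsto.clog
    · have : Continuous fun x : ℝ ↦ 1 - (x : ℂ) * e j := by fun_prop
      simpa using (this.tendsto 1).mono_left nhdsWithin_le_nhds
    · left
      have hre : (e j).re ≤ 1 := (Complex.re_le_norm _).trans (hnorm j).le
      rcases hre.lt_or_eq with h | h
      · simpa using h
      · exfalso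
        apply hne j hj
        have hn := hnorm j
        have := Complex.sq_norm (e j)
        rw [hn, Complex.normSq_apply, h] at this
        apply Complex.ext
        · simpa using h
        · have : (e j).im * (e j).im = 0 := by linarith
          simpa using this
  have heq : ∀ᶠ x : ℝ in 𝓝[<] 1, gaussSum χ⁻¹ e *
      ∑' n : ℕ, χ (n : ZMod p) / n * (x : ℂ) ^ n =
      ∑ j : ZMod p, χ⁻¹ j * (-Complex.log (1 - x * e j)) := by
    have : Set.Ioo (0 : ℝ) 1 ∈ 𝓝[<] (1 : ℝ) := Ioo_mem_nhdsLT (by norm_num)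
    filter_upwards [this] with x hx
    have hs : ∀ j : ZMod p, HasSum (fun n : ℕ ↦ χ⁻¹ j * (((x : ℂ) * e j) ^ n / n))
        (χ⁻¹ j * (-Complex.log (1 - x * e j))) := by
      intro j
      apply HasSum.mul_left
      apply Complex.hasSum_taylorSeries_neg_log
      rw [norm_mul, hnorm, mul_one, Complex.norm_real, Real.norm_eq_abs, abs_of_pos hx.1]
      exact hx.2
    have hs' := hasSum_sum (s := Finset.univ) (fun j _ ↦ hs j)
    rw [← hs'.tsum_eq, ← tsum_mul_left]
    congr 1
    ext n
    rw [show gaussSum χ⁻¹ e * (χ (n : ZMod p) / n * (x : ℂ) ^ n)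
      = (gaussSum χ⁻¹ e * χ (n : ZMod p)) * ((x : ℂ) ^ n / n) by ring, hchar, Finset.sum_mul]
    apply Finset.sum_congr rfl
    intro j _
    ring
  have hmain := tendsto_nhds_unique (hab'.congr' heq) hlog
  rw [hΛ, hmain]
  have hev : ∀ j : ZMod p, χ⁻¹ (-j) = χ⁻¹ j := by
    intro j
    have h1 : χ (-1) = 1 := heven
    have : χ⁻¹ (-1) = 1 := by rw [MulChar.inv_apply', inv_neg_one, h1]
    rw [← neg_one_mul, map_mul, this, one_mul]
  have hneg : ∑ j : ZMod p, χ⁻¹ j * (-Complex.log (1 - e j)) =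
      ∑ j : ZMod p, χ⁻¹ j * (-Complex.log (1 - e (-j))) := by
    rw [← Equiv.sum_comp (Equiv.neg (ZMod p))]
    apply Finset.sum_congr rfl
    intro j _
    simp only [Equiv.neg_apply, hev]
  have htwo : (2 : ℂ) * ∑ j : ZMod p, χ⁻¹ j * (-Complex.log (1 - e j)) =
      2 * (-∑ j : ZMod p, χ⁻¹ j * (Real.log ‖1 - e j‖ : ℝ)) := by
    rw [two_mul]
    nth_rewrite 2 [hneg]
    rw [← Finset.sum_add_distrib, ← Finset.sum_neg_distrib, Finset.mul_sum]
    apply Finset.sum_congr rfl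
    intro j _
    by_cases hj : j = 0
    · subst hj; simp [hc0]
    have hconj : e (-j) = (starRingEnd ℂ) (e j) := by
      rw [AddChar.map_neg_eq_conj]
    have hre : 0 < (1 - e j).re := by
      have hre : (e j).re ≤ 1 := (Complex.re_le_norm _).trans (hnorm j).le
      rcases hre.lt_or_eq with h | h
      · simpa using h
      · exfalso
        apply hne j hj
        have hn := hnorm j
        have := Complex.sq_norm (e j)
        rw [hn, Complex.normSq_apply, h] at this
        apply Complex.ext
        · simpa using h
        · have : (e j).im * (e j).im = 0 := by linarith
          simpa using this
    have hl : Complex.log (1 - e (-j)) = (starRingEnd ℂ) (Complex.log (1 - e j)) := by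
      rw [← Complex.log_conj]
      · simp [hconj]
      · intro h
        have := Complex.arg_eq_pi_iff.mp h
        linarith [this.1]
    rw [hl]
    have h3 := Complex.add_conj (Complex.log (1 - e j))
    rw [Complex.log_re] at h3
    calc _ = -(χ⁻¹ j * (Complex.log (1 - e j) + (starRingEnd ℂ) (Complex.log (1 - e j)))) := by ring
      _ = _ := by rw [h3]; push_cast; ring
  exact mul_left_cancel₀ two_ne_zero htwo

/-- nonzero elements all of whose prime divisors lie in `S` -/
def smoothSet {M : Type*} [CommMonoidWithZero M] (S : Finset M) : Set M :=
  {I | I ≠ 0 ∧ ∀ P, Prime P → P ∣ I → P ∈ S}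

lemma smooth_hasSum {M : Type*} [CommMonoidWithZero M] [Nontrivial M]
    [UniqueFactorizationMonoid M] [Unique Mˣ] [DecidableEq M]
    (f : M → ℝ) (h1 : f 1 = 1) (hmul : ∀ a b, f (a * b) = f a * f b) (h0 : ∀ a, 0 ≤ f a)
    (hlt : ∀ P, Prime P → f P < 1) (S : Finset M) (hS : ∀ P ∈ S, Prime P) :
    HasSum (fun I : smoothSet S => f I) (∏ P ∈ S, (1 - f P)⁻¹) := by
  induction S using Finset.induction_on with
  | empty =>
    have hE : smoothSet (∅ : Finset M) = {1} := by
      ext I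
      simp only [smoothSet, Set.mem_ofPred_eq, Finset.notMem_empty, Set.mem_singleton_iff]
      constructor
      · rintro ⟨hI, h⟩
        by_contra hne
        have hnu : ¬ IsUnit I := fun hu => hne (by
          obtain ⟨u, rfl⟩ := hu
          rw [Subsingleton.elim u 1]; rfl)
        obtain ⟨P, hP, hPI⟩ := WfDvdMonoid.exists_irreducible_factor hnu hI
        exact h P (UniqueFactorizationMonoid.irreducible_iff_prime.1 hP) hPI
      · rintro rfl
        exact ⟨one_ne_zero, fun P hP hd => hP.not_isUnit (isUnit_of_dvd_one hd)⟩
    rw [hE]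
    simpa [h1] using (hasSum_unique (fun I : ({1} : Set M) => f I))
  | insert P S hPS ih =>
    have hP : Prime P := hS P (Finset.mem_insert_self _ _)
    have ih' := ih (fun Q hQ => hS Q (Finset.mem_insert_of_mem hQ))
    have hpow : ∀ k, f (P ^ k) = f P ^ k := by
      intro k
      induction k with
      | zero => simp [h1]
      | succ k ihk => rw [pow_succ, hmul, ihk, pow_succ]
    have hgeo := hasSum_geometric_of_lt_one (h0 P) (hlt P hP)
    have hprod := hgeo.mul ih' (hgeo.summable.mul_of_nonneg ih'.summable
      (fun k => pow_nonneg (h0 P) k) (fun I => h0 _))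
    let φ : ℕ × smoothSet S → smoothSet (insert P S) := fun x =>
      ⟨P ^ x.1 * x.2.1, mul_ne_zero (pow_ne_zero _ hP.ne_zero) x.2.2.1, by
        intro Q hQ hd
        rcases hQ.dvd_or_dvd hd with h | h
        · have := hQ.dvd_of_dvd_pow h
          have := (hQ.irreducible.associated_of_dvd hP.irreducible this)
          rw [associated_iff_eq.1 this]; exact Finset.mem_insert_self _ _
        · exact Finset.mem_insert_of_mem (x.2.2.2 Q hQ h)⟩
    have hφ : Function.Bijective φ := by
      constructor
      · rintro ⟨k, I, hI⟩ ⟨l, J, hJ⟩ h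
        have h' : P ^ k * I = P ^ l * J := congrArg Subtype.val h
        have hPI : ¬ P ∣ I := fun hd => hPS (hI.2 P hP hd)
        have hPJ : ¬ P ∣ J := fun hd => hPS (hJ.2 P hP hd)
        have hkl : k = l := by
          rcases lt_trichotomy k l with hlt | heq | hgt
          · exfalso
            obtain ⟨m, rfl⟩ := Nat.exists_eq_add_of_lt hlt
            rw [add_assoc, pow_add, mul_assoc] at h'
            have := mul_left_cancel₀ (pow_ne_zero _ hP.ne_zero) h'
            exact hPI (this ▸ (dvd_mul_of_dvd_left (dvd_pow_self _ (by omega)) _))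
          · exact heq
          · exfalso
            obtain ⟨m, rfl⟩ := Nat.exists_eq_add_of_lt hgt
            rw [add_assoc, pow_add, mul_assoc] at h'
            have := mul_left_cancel₀ (pow_ne_zero _ hP.ne_zero) h'
            exact hPJ (this ▸ (dvd_mul_of_dvd_left (dvd_pow_self _ (by omega)) _))
        subst hkl
        have := mul_left_cancel₀ (pow_ne_zero _ hP.ne_zero) h'
        subst this; rfl
      · rintro ⟨I, hI⟩
        have hfin : FiniteMultiplicity P I := FiniteMultiplicity.of_prime_left hP hI.1
        obtain ⟨J, hJ, hnd⟩ := hfin.exists_eq_pow_mul_and_not_dvd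
        refine ⟨⟨multiplicity P I, J, ?_, ?_⟩, Subtype.ext hJ.symm⟩
        · rintro rfl; exact hnd (dvd_zero _)
        · intro Q hQ hd
          have := hI.2 Q hQ (hJ ▸ dvd_mul_of_dvd_right hd _)
          rcases Finset.mem_insert.1 this with h | h
          · subst h; exact absurd hd hnd
          · exact h
    rw [Finset.prod_insert hPS, ← (Equiv.ofBijective φ hφ).hasSum_iff]
    have hfun : ((fun I : smoothSet (insert P S) => f I) ∘ (Equiv.ofBijective φ hφ)) =
        fun x : ℕ × smoothSet S => f P ^ x.1 * f x.2 := by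
      funext x
      simp only [Function.comp, Equiv.ofBijective_apply, φ, hmul, hpow]
    rw [hfun]
    exact hprod

lemma smooth_tendsto {M : Type*} [CommMonoidWithZero M] [Nontrivial M]
    [UniqueFactorizationMonoid M] [Unique Mˣ] [DecidableEq M]
    (f : M → ℝ) (h1 : f 1 = 1) (hmul : ∀ a b, f (a * b) = f a * f b) (h0 : ∀ a, 0 ≤ f a)
    (hzero : f 0 = 0)
    (hlt : ∀ P, Prime P → f P < 1) (S : ℕ → Finset M) (hS : ∀ N, ∀ P ∈ S N, Prime P)
    (hev : ∀ P, Prime P → ∀ᶠ N in atTop, P ∈ S N) {Z : ℝ} (hZ : HasSum f Z) :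
    Tendsto (fun N => ∏ P ∈ S N, (1 - f P)⁻¹) atTop (𝓝 Z) := by
  have key : ∀ N, ∏ P ∈ S N, (1 - f P)⁻¹ = ∑' I, (smoothSet (S N)).indicator f I := by
    intro N
    rw [← _root_.tsum_subtype]
    exact (smooth_hasSum f h1 hmul h0 hlt (S N) (hS N)).tsum_eq.symm
  simp_rw [key]
  rw [← hZ.tsum_eq]
  refine tendsto_tsum_of_dominated_convergence hZ.summable ?_ ?_
  · intro I
    by_cases hI : I = 0
    · subst hI
      have : ∀ N, (smoothSet (S N)).indicator f 0 = f 0 := by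
        intro N
        by_cases h : (0 : M) ∈ smoothSet (S N)
        · rw [Set.indicator_of_mem h]
        · rw [Set.indicator_of_notMem h, hzero]
      simp_rw [this]
      exact tendsto_const_nhds
    · have hfin : ∀ᶠ N in atTop, ∀ P ∈ (UniqueFactorizationMonoid.factors I).toFinset, P ∈ S N := by
        rw [Filter.eventually_all_finset]
        intro P hP
        exact hev P (UniqueFactorizationMonoid.prime_of_factor P (Multiset.mem_toFinset.1 hP))
      refine tendsto_const_nhds.congr' ?_
      filter_upwards [hfin] with N hN
      rw [Set.indicator_of_mem]
      refine ⟨hI, fun P hP hd => hN P ?_⟩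
      obtain ⟨Q, hQ, hPQ⟩ := UniqueFactorizationMonoid.exists_mem_factors_of_dvd hI hP.irreducible hd
      rw [Multiset.mem_toFinset, associated_iff_eq.1 hPQ]
      exact hQ
  · refine Eventually.of_forall fun N I => ?_
    by_cases h : I ∈ smoothSet (S N)
    · rw [Set.indicator_of_mem h, Real.norm_of_nonneg (h0 I)]
    · rw [Set.indicator_of_notMem h, norm_zero]; exact h0 I

open NumberField in
lemma ded_hasSum (F : Type*) [Field F] [NumberField F] (s : ℝ) (hs : 1 < s)
    (hne : dedekindZeta F s ≠ 0) :
    ∃ Z : ℝ, (Z : ℂ) = dedekindZeta F s ∧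
      HasSum (fun I : Ideal (𝓞 F) => (Ideal.absNorm I : ℝ) ^ (-s)) Z := by
  set g : ℕ → ℝ := fun n => (Nat.card {I : Ideal (𝓞 F) // Ideal.absNorm I = n} : ℝ) * (n : ℝ) ^ (-s)
    with hg
  have hterm : ∀ n, LSeries.term (fun n ↦ (Nat.card {I : Ideal (𝓞 F) // Ideal.absNorm I = n} : ℂ))
      s n = (g n : ℂ) := by
    intro n
    rw [LSeries.term_def]
    split_ifs with h
    · subst h
      simp [hg, Real.zero_rpow (by linarith : -s ≠ 0)]
    · simp only [hg]
      push_cast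
      rw [Complex.ofReal_cpow (Nat.cast_nonneg n)]
      push_cast
      rw [Complex.cpow_neg, div_eq_mul_inv]
  have hsum : Summable (fun n => (g n : ℂ)) := by
    by_contra h
    apply hne
    rw [dedekindZeta, LSeries]
    simp_rw [hterm]
    exact tsum_eq_zero_of_not_summable h
  have hsumR : Summable g := Complex.summable_ofReal.1 hsum
  refine ⟨∑' n, g n, ?_, ?_⟩
  · rw [dedekindZeta, LSeries]
    simp_rw [hterm]
    exact Complex.ofReal_tsum _
  · rw [← (Equiv.sigmaFiberEquiv (fun I : Ideal (𝓞 F) => Ideal.absNorm I)).hasSum_iff]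
    have hfin : ∀ n, Finite {I : Ideal (𝓞 F) // Ideal.absNorm I = n} := fun n =>
      (Ideal.finite_setOfPred_absNorm_eq n).to_subtype
    have hfib : ∀ n, HasSum (fun I : {I : Ideal (𝓞 F) // Ideal.absNorm I = n} =>
        (Ideal.absNorm (I : Ideal (𝓞 F)) : ℝ) ^ (-s)) (g n) := by
      intro n
      have := hfin n
      have := Fintype.ofFinite {I : Ideal (𝓞 F) // Ideal.absNorm I = n}
      have h2 : (fun I : {I : Ideal (𝓞 F) // Ideal.absNorm I = n} =>
        (Ideal.absNorm (I : Ideal (𝓞 F)) : ℝ) ^ (-s)) = fun _ => (n : ℝ) ^ (-s) := by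
        funext I; rw [I.2]
      rw [h2]
      convert hasSum_fintype (fun _ : {I : Ideal (𝓞 F) // Ideal.absNorm I = n} => (n : ℝ) ^ (-s))
      simp [hg, Nat.card_eq_fintype_card]
    have hS : Summable ((fun I : Ideal (𝓞 F) => (Ideal.absNorm I : ℝ) ^ (-s)) ∘
        (Equiv.sigmaFiberEquiv (fun I : Ideal (𝓞 F) => Ideal.absNorm I))) := by
      rw [summable_sigma_of_nonneg]
      · refine ⟨fun n => (hfib n).summable, ?_⟩
        refine hsumR.congr fun n => ?_
        exact ((hfib n).tsum_eq).symm
      · intro x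
        exact Real.rpow_nonneg (Nat.cast_nonneg _) _
    have := hS.hasSum.sigma hfib
    rw [this.tsum_eq]
    exact hS.hasSum

open NumberField in
lemma ded_euler (F : Type*) [Field F] [NumberField F] (s : ℝ) (hs : 1 < s)
    (hne : dedekindZeta F s ≠ 0) [DecidableEq (Ideal (𝓞 F))]
    (S : ℕ → Finset (Ideal (𝓞 F))) (hS : ∀ N, ∀ P ∈ S N, Prime P)
    (hev : ∀ P, Prime P → ∀ᶠ N in atTop, P ∈ S N) :
    ∃ Z : ℝ, (Z : ℂ) = dedekindZeta F s ∧
      Tendsto (fun N => ∏ P ∈ S N, (1 - (Ideal.absNorm P : ℝ) ^ (-s))⁻¹) atTop (𝓝 Z) := by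
  obtain ⟨Z, hZ, hsum⟩ := ded_hasSum F s hs hne
  refine ⟨Z, hZ, smooth_tendsto (fun I : Ideal (𝓞 F) => (Ideal.absNorm I : ℝ) ^ (-s)) ?_ ?_ ?_ ?_ ?_
    S hS hev hsum⟩
  · simp
  · intro a b
    simp only [map_mul, Nat.cast_mul]
    exact Real.mul_rpow (Nat.cast_nonneg _) (Nat.cast_nonneg _)
  · intro a
    exact Real.rpow_nonneg (Nat.cast_nonneg _) _
  · simp [Real.zero_rpow (by linarith : -s ≠ 0)]
  · intro P hP
    apply Real.rpow_lt_one_of_one_lt_of_neg _ (by linarith)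
    have h0 : Ideal.absNorm P ≠ 0 := by
      rw [Ne, Ideal.absNorm_eq_zero_iff]; exact hP.ne_zero
    have h1 : Ideal.absNorm P ≠ 1 := by
      rw [Ne, Ideal.absNorm_eq_one_iff]
      exact fun h => hP.not_isUnit (Ideal.isUnit_iff.2 h)
    exact_mod_cast (by omega : 1 < Ideal.absNorm P)

open NumberField

/-- The sequence `x ^ a + x ^ (-a)` as a polynomial in `x + x⁻¹`. -/
def etaR {R : Type*} [CommRing R] (x : R) : ℕ → R
  | 0 => 2
  | 1 => x
  | (n + 2) => x * etaR x (n + 1) - etaR x n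

lemma etaR_map {R S : Type*} [CommRing R] [CommRing S] (f : R →+* S) (x : R) (n : ℕ) :
    f (etaR x n) = etaR (f x) n := by
  induction n using Nat.strong_induction_on with
  | _ n ih =>
    match n with
    | 0 => exact map_ofNat f 2
    | 1 => simp [etaR]
    | (n + 2) => simp [etaR, ih n (by omega), ih (n + 1) (by omega)]

lemma etaR_eq {R : Type*} [CommRing R] (z w : R) (h : z * w = 1) (n : ℕ) :
    etaR (z + w) n = z ^ n + w ^ n := by
  induction n using Nat.strong_induction_on with
  | _ n ih =>
    match n with
    | 0 => simp [etaR]; norm_num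
    | 1 => simp [etaR]
    | (n + 2) =>
      rw [etaR, ih n (by omega), ih (n + 1) (by omega)]
      have : (z + w) * (z ^ (n + 1) + w ^ (n + 1)) - (z ^ n + w ^ n) =
        z ^ (n + 2) + w ^ (n + 2) + (z * w - 1) * (z ^ n + w ^ n) := by ring
      rw [this, h]; ring

section setup
variable {p : ℕ} [hpf : Fact p.Prime] {F E : Type*} [Field F] [NumberField F] [Field E]
  [NumberField E] [Algebra F E] [hcyc : IsCyclotomicExtension {p} ℚ E] {ζ : E}

lemma exists_conjE (hζ : IsPrimitiveRoot ζ p) : ∃ σ : E ≃ₐ[ℚ] E, σ ζ = ζ⁻¹ := by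
  refine ⟨(IsCyclotomicExtension.Rat.galEquivZMod p E).symm (-1), ?_⟩
  rw [IsCyclotomicExtension.Rat.galEquivZMod_apply_of_pow_eq p E _ hζ.pow_eq_one]
  simp only [MulEquiv.apply_symm_apply, Units.val_neg, Units.val_one]
  apply eq_inv_of_mul_eq_one_left
  rw [← pow_succ, hζ.pow_eq_one_iff_dvd,
    ← ZMod.natCast_eq_zero_iff]
  push_cast
  rw [ZMod.natCast_zmod_val]
  ring

lemma algHom_eq_of_top {F : Type*} [Field F] [CharZero F] {η : F} (htop : Algebra.adjoin ℚ {η} = ⊤) {A : Type*} [Field A]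
    [Algebra ℚ A] (f g : F →ₐ[ℚ] A) (h : f η = g η) : f = g := by
  apply AlgHom.ext_of_adjoin_eq_top htop
  intro x hx
  rw [Set.mem_singleton_iff.1 hx]; exact h

lemma conj_fix {η : F} (hη : algebraMap F E η = ζ + ζ⁻¹) (htop : Algebra.adjoin ℚ {η} = ⊤)
    {σ : E ≃ₐ[ℚ] E} (hσ : σ ζ = ζ⁻¹) (x : F) : σ (algebraMap F E x) = algebraMap F E x := by
  have h := algHom_eq_of_top htop ((σ : E →ₐ[ℚ] E).comp (Algebra.algHom ℚ F E)) (Algebra.algHom ℚ F E)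
    (by simp [Algebra.algHom, hη, hσ, add_comm])
  exact congrArg (fun f => f x) h

lemma zeta_ne_inv (hp2 : p ≠ 2) (hζ : IsPrimitiveRoot ζ p) : ζ ≠ ζ⁻¹ := by
  intro h
  have h0 := hζ.ne_zero hpf.out.ne_zero
  have : ζ ^ 2 = 1 := by
    rw [pow_two]; nth_rewrite 2 [h]; exact mul_inv_cancel₀ h0
  have := Nat.le_of_dvd (by norm_num) ((hζ.pow_eq_one_iff_dvd 2).1 this)
  have := hpf.out.two_le
  omega

lemma finrank_FE (hp2 : p ≠ 2) (hζ : IsPrimitiveRoot ζ p) {η : F}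
    (hη : algebraMap F E η = ζ + ζ⁻¹) (htop : Algebra.adjoin ℚ {η} = ⊤) :
    Module.finrank F E = 2 := by
  have h0 := hζ.ne_zero hpf.out.ne_zero
  have hintg : IsIntegral F ζ := Algebra.IsIntegral.isIntegral ζ
  have hadj : IntermediateField.adjoin F {ζ} = ⊤ := by
    have h1 : Algebra.adjoin ℚ {ζ} = ⊤ := IsCyclotomicExtension.adjoin_primitive_root_eq_top hζ
    rw [eq_top_iff]
    intro x _
    have hx : x ∈ Algebra.adjoin ℚ {ζ} := by rw [h1]; trivial
    have hle : Algebra.adjoin ℚ {ζ} ≤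
      ((IntermediateField.adjoin F {ζ}).toSubalgebra.restrictScalars ℚ) :=
      Algebra.adjoin_le (by simp)
    exact hle hx
  have hfr : Module.finrank F E = (minpoly F ζ).natDegree := by
    rw [← IntermediateField.adjoin.finrank hintg, hadj, IntermediateField.finrank_top']
  rw [hfr]
  apply le_antisymm
  · have hq : (Polynomial.X ^ 2 - Polynomial.C η * Polynomial.X + 1 : Polynomial F).natDegree = 2 := by
      compute_degree!
    rw [← hq]
    apply Polynomial.natDegree_le_of_dvd
    · apply minpoly.dvd
      simp only [map_add, map_sub, map_pow, map_mul, Polynomial.aeval_X, Polynomial.aeval_C, hη, map_one]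
      field_simp
      ring
    · intro h; rw [h] at hq; simp at hq
  · rw [minpoly.two_le_natDegree_iff hintg]
    rintro ⟨x, hx⟩
    obtain ⟨σ, hσ⟩ := exists_conjE hζ
    have := conj_fix hη htop hσ x
    rw [hx, hσ] at this
    exact zeta_ne_inv hp2 hζ this.symm

lemma finrank_F (hp2 : p ≠ 2) (hζ : IsPrimitiveRoot ζ p) {η : F}
    (hη : algebraMap F E η = ζ + ζ⁻¹) (htop : Algebra.adjoin ℚ {η} = ⊤) :
    Module.finrank ℚ F = (p - 1) / 2 := by
  have h1 : Module.finrank ℚ E = p - 1 := by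
    rw [IsCyclotomicExtension.finrank E (Polynomial.cyclotomic.irreducible_rat hpf.out.pos),
      Nat.totient_prime hpf.out]
  have h2 := Module.finrank_mul_finrank ℚ F E
  rw [finrank_FE hp2 hζ hη htop, h1] at h2
  omega

lemma dvd_descent {F E : Type*} [Field F] [Field E] [Algebra F E] {a b : 𝓞 F} (h : algebraMap (𝓞 F) (𝓞 E) a ∣ algebraMap (𝓞 F) (𝓞 E) b) : a ∣ b := by
  by_cases ha : a = 0
  · subst ha
    rw [map_zero, zero_dvd_iff, map_eq_zero_iff _ (FaithfulSMul.algebraMap_injective _ _)] at h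
    rw [h]
  obtain ⟨c, hc⟩ := h
  have ha' : (a : F) ≠ 0 := RingOfIntegers.coe_ne_zero_iff.2 ha
  have hcE : algebraMap F E (b : F) = algebraMap F E (a : F) * (c : E) := by
    exact congrArg (fun x : 𝓞 E => (x : E)) hc
  have hq : algebraMap F E ((b : F) / (a : F)) = (c : E) := by
    rw [map_div₀, hcE, mul_div_cancel_left₀]
    exact (map_ne_zero _).2 ha'
  have hintg : IsIntegral ℤ ((b : F) / (a : F)) := by
    rw [← isIntegral_algebraMap_iff (FaithfulSMul.algebraMap_injective F E), hq]
    exact c.isIntegral_coe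
  refine ⟨⟨_, hintg⟩, ?_⟩
  apply RingOfIntegers.coe_injective
  show (b : F) = (a : F) * ((b : F) / (a : F))
  field_simp

end setup

section setup
variable {p : ℕ} [hpf : Fact p.Prime] {F E : Type*} [Field F] [NumberField F] [Field E]
  [NumberField E] [Algebra F E] [hcyc : IsCyclotomicExtension {p} ℚ E] {ζ : E}

lemma prime_not_unit (K : Type*) [Field K] [NumberField K] {q : ℕ} (hq : q.Prime) :
    ¬ IsUnit (q : 𝓞 K) := by
  intro h
  have h1 := h.map (Algebra.norm ℤ)
  have h2 : Algebra.norm ℤ (q : 𝓞 K) = (q : ℤ) ^ Module.finrank ℤ (𝓞 K) := by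
    simpa using Algebra.norm_algebraMap (S := 𝓞 K) (q : ℤ)
  rw [h2, isUnit_pow_iff] at h1
  · rw [Int.isUnit_iff_natAbs_eq] at h1
    simp at h1
    exact hq.one_lt.ne' h1
  · exact (Module.finrank_pos).ne'

lemma etaO_map (hζ : IsPrimitiveRoot ζ p) {η : 𝓞 F} (hη : algebraMap F E η = ζ + ζ⁻¹) :
    algebraMap (𝓞 F) (𝓞 E) η = hζ.toInteger + hζ.inv.toInteger := by
  apply RingOfIntegers.coe_injective
  exact hη

lemma zw_one (hζ : IsPrimitiveRoot ζ p) : hζ.toInteger * hζ.inv.toInteger = 1 := by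
  apply RingOfIntegers.coe_injective
  show ζ * ζ⁻¹ = 1
  exact mul_inv_cancel₀ (hζ.ne_zero hpf.out.ne_zero)

lemma zpow_congr (hζ : IsPrimitiveRoot ζ p) {a b : ℕ} (h : (a : ZMod p) = b) :
    hζ.toInteger ^ a = hζ.toInteger ^ b := by
  rw [ZMod.natCast_eq_natCast_iff] at h
  have h1 : orderOf hζ.toInteger = p := hζ.toInteger_isPrimitiveRoot.eq_orderOf.symm
  rw [← pow_mod_orderOf _ a, ← pow_mod_orderOf _ b, h1]
  exact congrArg _ h

lemma sq_eq_one_iff_of_side {R : Type*} [CommRing R] [NoZeroDivisors R] {x : R} (h : x ^ 2 = 1) :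
    x = 1 ∨ x = -1 := by
  rw [← sq_eq_sq_iff_eq_or_eq_neg, h, one_pow]

lemma frob_dvd (hζ : IsPrimitiveRoot ζ p) {η : 𝓞 F}
    (hη : algebraMap F E η = ζ + ζ⁻¹) (htop : Algebra.adjoin ℚ {(η : F)} = ⊤)
    {q : ℕ} (hq : q.Prime) (k : ℕ) (hk : ((q : ZMod p) ^ k) ^ 2 = 1) (y : 𝓞 F) :
    (q : 𝓞 F) ∣ y ^ (q ^ k) - y := by
  have : Fact q.Prime := ⟨hq⟩
  apply dvd_descent (E := E)
  have hex : ∃ σ : 𝓞 E →+* 𝓞 E, σ hζ.toInteger = hζ.toInteger ^ (q ^ k) ∧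
      σ (algebraMap (𝓞 F) (𝓞 E) y) = algebraMap (𝓞 F) (𝓞 E) y := by
    rcases sq_eq_one_iff_of_side hk with h | h
    · refine ⟨RingHom.id _, ?_, rfl⟩
      have : hζ.toInteger ^ (q ^ k) = hζ.toInteger ^ 1 := by
        apply zpow_congr hζ
        push_cast; exact h
      rw [this, pow_one]; rfl
    · obtain ⟨τ, hτ⟩ := exists_conjE hζ
      refine ⟨RingOfIntegers.mapRingHom (τ : E →+* E), ?_, ?_⟩
      · have h1 : hζ.toInteger ^ (q ^ k) * hζ.toInteger = 1 := by
          rw [← pow_succ, ← pow_zero hζ.toInteger]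
          apply zpow_congr hζ
          push_cast; rw [h]; ring
        have h2 : hζ.toInteger ^ (q ^ k) = hζ.inv.toInteger := by
          calc _ = hζ.toInteger ^ (q ^ k) * (hζ.toInteger * hζ.inv.toInteger) := by
                rw [zw_one, mul_one]
            _ = _ := by rw [← mul_assoc, h1, one_mul]
        rw [h2]
        apply RingOfIntegers.coe_injective
        exact hτ
      · apply RingOfIntegers.coe_injective
        exact conj_fix hη htop hτ (y : F)
  obtain ⟨σ, hσz, hσy⟩ := hex
  have : CharP (𝓞 E ⧸ Ideal.span {(q : 𝓞 E)}) q :=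
    CharP.quotient _ _ (prime_not_unit E hq)
  let f1 : 𝓞 E →+* (𝓞 E ⧸ Ideal.span {(q : 𝓞 E)}) :=
    (iterateFrobenius _ q k).comp (Ideal.Quotient.mk _)
  let f2 : 𝓞 E →+* (𝓞 E ⧸ Ideal.span {(q : 𝓞 E)}) := (Ideal.Quotient.mk _).comp σ
  have hadj : Algebra.adjoin ℤ {hζ.toInteger} = ⊤ := by
    rw [← hζ.integralPowerBasis.adjoin_gen_eq_top, hζ.integralPowerBasis_gen]
  have h12 : f1.toIntAlgHom = f2.toIntAlgHom := by
    apply AlgHom.ext_of_adjoin_eq_top hadj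
    intro x hx
    rw [Set.mem_singleton_iff.1 hx]
    show f1 _ = f2 _
    simp only [f1, f2, RingHom.comp_apply, hσz, iterateFrobenius_def, map_pow]
  have h3 : f1 (algebraMap (𝓞 F) (𝓞 E) y) = f2 (algebraMap (𝓞 F) (𝓞 E) y) :=
    congrArg (fun f => f (algebraMap (𝓞 F) (𝓞 E) y)) h12
  simp only [f1, f2, RingHom.comp_apply, hσy, iterateFrobenius_def] at h3
  rw [← map_pow, Ideal.Quotient.eq, Ideal.mem_span_singleton] at h3
  simpa using h3


lemma pow_sub_one_dvd (hζ : IsPrimitiveRoot ζ p) {b : ℕ} (hb : (b : ZMod p) ≠ 0) :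
    hζ.toInteger ^ b - 1 ∣ (p : 𝓞 E) := by
  have hc : b.Coprime p := by
    rw [Nat.coprime_comm, hpf.out.coprime_iff_not_dvd, ← ZMod.natCast_eq_zero_iff]
    exact hb
  exact (hζ.pow_of_coprime b hc).toInteger_sub_one_dvd_prime'

lemma frob_lower (hζ : IsPrimitiveRoot ζ p) {η : 𝓞 F}
    (hη : algebraMap F E η = ζ + ζ⁻¹)
    {q : ℕ} (hq : q.Prime) (hqp : q ≠ p) (f : ℕ) (P : Ideal (𝓞 F)) [hP : P.IsPrime]
    (hqP : (q : 𝓞 F) ∈ P) (hf : ∀ y : 𝓞 F, y ^ (q ^ f) - y ∈ P) :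
    ((q : ZMod p) ^ f) ^ 2 = 1 := by
  have : Fact q.Prime := ⟨hq⟩
  by_contra hne
  set Q := q ^ f with hQ
  have hQ1 : 1 ≤ Q := Nat.one_le_pow _ _ hq.pos
  have h1 : (q : 𝓞 F) ∣ η ^ Q - etaR η Q := by
    apply dvd_descent (E := E)
    have : CharP (𝓞 E ⧸ Ideal.span {(q : 𝓞 E)}) q :=
      CharP.quotient _ _ (prime_not_unit E hq)
    rw [map_sub, etaR_map, map_pow, etaO_map hζ hη, etaR_eq _ _ (zw_one hζ), map_natCast,
      ← Ideal.mem_span_singleton, ← Ideal.Quotient.eq]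
    simp only [map_add, map_pow]
    rw [hQ, add_pow_char_pow]
  have h2 : etaR η Q - η ∣ (p : 𝓞 F) ^ 2 := by
    apply dvd_descent (E := E)
    rw [map_sub, etaR_map, etaO_map hζ hη, etaR_eq _ _ (zw_one hζ), map_pow, map_natCast]
    set z := hζ.toInteger
    set w := hζ.inv.toInteger
    have hzw : z * w = 1 := zw_one hζ
    have hfac : z ^ Q + w ^ Q - (z + w) = w ^ Q * ((z ^ (Q - 1) - 1) * (z ^ (Q + 1) - 1)) := by
      obtain ⟨m, hm⟩ : ∃ m, Q = m + 1 := ⟨Q - 1, by omega⟩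
      rw [hm]
      have e1 : w ^ (m + 1) * z ^ (m + 1) = 1 := by rw [← mul_pow, mul_comm w, hzw, one_pow]
      have e2 : w ^ m * z ^ m = 1 := by rw [← mul_pow, mul_comm w, hzw, one_pow]
      simp only [Nat.add_sub_cancel]
      linear_combination (-z ^ (m + 1) + z) * e1 + w * e2
    have hwu : IsUnit (w ^ Q) := (IsUnit.of_mul_eq_one z (by rw [mul_comm, hzw])).pow Q
    rw [hfac, hwu.mul_left_dvd, pow_two]
    have hQc : ((q : ZMod p) ^ f) = (Q : ZMod p) := by rw [hQ]; push_cast; rfl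
    rw [hQc] at hne
    apply mul_dvd_mul
    · apply pow_sub_one_dvd
      intro h
      apply hne
      rw [Nat.cast_sub hQ1] at h
      have : (Q : ZMod p) = 1 := by
        simpa using sub_eq_zero.1 h
      rw [this, one_pow]
    · apply pow_sub_one_dvd
      intro h
      apply hne
      have : (Q : ZMod p) = -1 := by
        push_cast at h
        exact eq_neg_of_add_eq_zero_left h
      rw [this]; ring
  have h3 : etaR η Q - η ∈ P := by
    have e : etaR η Q - η = (η ^ Q - η) - (η ^ Q - etaR η Q) := by ring
    rw [e]
    exact P.sub_mem (hf η) (P.mem_of_dvd h1 hqP)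
  have h4 : (p : 𝓞 F) ∈ P := hP.mem_of_pow_mem 2 (P.mem_of_dvd h2 h3)
  have hcop : IsCoprime (p : ℤ) (q : ℤ) := by
    rw [Nat.isCoprime_iff_coprime]
    exact (Nat.coprime_primes hpf.out hq).2 (Ne.symm hqp)
  obtain ⟨a, b, hab⟩ := hcop
  have h5 : (1 : 𝓞 F) = (a : 𝓞 F) * p + b * q := by exact_mod_cast congrArg (Int.cast (R := 𝓞 F)) hab.symm
  exact hP.ne_top ((Ideal.eq_top_iff_one P).2 (h5 ▸ P.add_mem (P.mul_mem_left _ h4) (P.mul_mem_left _ hqP)))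

lemma absNorm_of_prime (hζ : IsPrimitiveRoot ζ p) {η : 𝓞 F}
    (hη : algebraMap F E η = ζ + ζ⁻¹) (htop : Algebra.adjoin ℚ {(η : F)} = ⊤)
    {q : ℕ} (hq : q.Prime) (hqp : q ≠ p) (P : Ideal (𝓞 F)) [hP : P.IsPrime]
    (hqP : (q : 𝓞 F) ∈ P) : Ideal.absNorm P = q ^ (orderOf ((q : ZMod p) ^ 2)) := by
  have : Fact q.Prime := ⟨hq⟩
  have hP0 : P ≠ ⊥ := by
    rintro rfl
    exact hq.ne_zero (by exact_mod_cast (Ideal.mem_bot.1 hqP))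
  have hmax : P.IsMaximal := hP.isMaximal hP0
  let _ := Ideal.Quotient.field P
  have hfin : Finite (𝓞 F ⧸ P) := Ideal.finiteQuotientOfFreeOfNeBot P hP0
  let _ := Fintype.ofFinite (𝓞 F ⧸ P)
  have hchar : CharP (𝓞 F ⧸ P) q := by
    have : ((q : ℕ) : 𝓞 F ⧸ P) = 0 := by
      rw [← map_natCast (Ideal.Quotient.mk P), Ideal.Quotient.eq_zero_iff_mem]
      exact hqP
    exact (CharP.charP_iff_prime_eq_zero hq).2 this
  obtain ⟨f, -, hf⟩ := FiniteField.card (𝓞 F ⧸ P) q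
  have habs : Ideal.absNorm P = q ^ (f : ℕ) := by
    rw [← hf, ← Nat.card_eq_fintype_card]
    rfl
  rw [habs]
  congr 1
  set d := orderOf ((q : ZMod p) ^ 2) with hd
  have hlow : ((q : ZMod p) ^ (f : ℕ)) ^ 2 = 1 := by
    refine frob_lower hζ hη hq hqp f P hqP fun y => ?_
    rw [← Ideal.Quotient.eq, map_pow, ← hf]
    exact FiniteField.pow_card _
  have hdf : d ∣ f := by
    rw [hd, orderOf_dvd_iff_pow_eq_one, ← pow_mul, mul_comm, pow_mul]; exact hlow
  have hdpos : 0 < d := Nat.pos_of_dvd_of_pos hdf f.pos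
  apply le_antisymm _ (Nat.le_of_dvd f.pos hdf)
  have hdd : ((q : ZMod p) ^ d) ^ 2 = 1 := by
    rw [← pow_mul, mul_comm, pow_mul]; exact pow_orderOf_eq_one _
  have hall : ∀ u : (𝓞 F ⧸ P)ˣ, u ^ (q ^ d - 1) = 1 := by
    intro u
    obtain ⟨y, hy⟩ := Ideal.Quotient.mk_surjective (u : 𝓞 F ⧸ P)
    have h1 : y ^ (q ^ d) - y ∈ P := P.mem_of_dvd (frob_dvd hζ hη htop hq d hdd y) hqP
    rw [← Ideal.Quotient.eq, map_pow, hy] at h1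
    have h2 : u ^ (q ^ d) = u := Units.ext (by push_cast; exact h1)
    have h3 : u ^ (q ^ d - 1) * u = u := by
      rw [← pow_succ, Nat.sub_add_cancel (Nat.one_le_pow _ _ hq.pos), h2]
    simpa using h3
  obtain ⟨g, hg⟩ := IsCyclic.exists_generator (α := (𝓞 F ⧸ P)ˣ)
  have ho := orderOf_eq_card_of_forall_mem_zpowers hg
  rw [Nat.card_units, Nat.card_eq_fintype_card, hf] at ho
  have hdv := orderOf_dvd_of_pow_eq_one (hall g)
  rw [ho] at hdv
  have h1d : 1 < q ^ d := Nat.one_lt_pow hdpos.ne' hq.one_lt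
  have := Nat.le_of_dvd (by omega) hdv
  exact (Nat.pow_le_pow_iff_right hq.one_lt).1 (by omega)

end setup

open scoped Classical in
/-- primes of `𝓞 F` dividing `q` -/
noncomputable def primesAt (F : Type*) [Field F] [NumberField F] (q : ℕ) : Finset (Ideal (𝓞 F)) :=
  (UniqueFactorizationMonoid.normalizedFactors (Ideal.span {(q : 𝓞 F)})).toFinset

lemma mem_primesAt {F : Type*} [Field F] [NumberField F] {q : ℕ} (hq : q ≠ 0) {P : Ideal (𝓞 F)} :
    P ∈ primesAt F q ↔ Prime P ∧ (q : 𝓞 F) ∈ P := by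
  have h0 : Ideal.span {(q : 𝓞 F)} ≠ 0 := by
    rw [Ne, Ideal.zero_eq_bot, Ideal.span_singleton_eq_bot]; exact_mod_cast hq
  rw [primesAt, Multiset.mem_toFinset, UniqueFactorizationMonoid.mem_normalizedFactors_iff h0,
    Ideal.dvd_iff_le, Ideal.span_singleton_le_iff_mem]

section setup
variable {p : ℕ} [hpf : Fact p.Prime] {F E : Type*} [Field F] [NumberField F] [Field E]
  [NumberField E] [Algebra F E] [hcyc : IsCyclotomicExtension {p} ℚ E] {ζ : E}

lemma absNorm_span_nat (F : Type*) [Field F] [NumberField F] (q : ℕ) :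
    Ideal.absNorm (Ideal.span {(q : 𝓞 F)}) = q ^ Module.finrank ℚ F := by
  rw [Ideal.absNorm_span_singleton]
  have h2 : Algebra.norm ℤ (q : 𝓞 F) = (q : ℤ) ^ Module.finrank ℤ (𝓞 F) := by
    simpa using Algebra.norm_algebraMap (S := 𝓞 F) (q : ℤ)
  rw [h2, RingOfIntegers.rank, Int.natAbs_pow, Int.natAbs_natCast]

lemma order_pos {q : ℕ} (hq : q.Prime) (hqp : q ≠ p) : 0 < orderOf ((q : ZMod p) ^ 2) := by
  rw [orderOf_pos_iff, isOfFinOrder_iff_pow_eq_one]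
  refine ⟨p - 1, Nat.sub_pos_of_lt hpf.out.one_lt, ZMod.pow_card_sub_one_eq_one ?_⟩
  apply pow_ne_zero
  rw [Ne, ZMod.natCast_eq_zero_iff, Nat.prime_dvd_prime_iff_eq hpf.out hq]
  exact fun h => hqp h.symm

lemma span_squarefree (hζ : IsPrimitiveRoot ζ p) {η : 𝓞 F}
    (hη : algebraMap F E η = ζ + ζ⁻¹) (htop : Algebra.adjoin ℚ {(η : F)} = ⊤)
    {q : ℕ} (hq : q.Prime) (hqp : q ≠ p) : Squarefree (Ideal.span {(q : 𝓞 F)}) := by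
  have h0 : Ideal.span {(q : 𝓞 F)} ≠ 0 := by
    rw [Ne, Ideal.zero_eq_bot, Ideal.span_singleton_eq_bot]; exact_mod_cast hq.ne_zero
  rw [← isRadical_iff_squarefree_of_ne_zero h0]
  intro n J hJ
  rw [Ideal.dvd_iff_le] at hJ ⊢
  intro y hy
  rw [Ideal.mem_span_singleton]
  have hd := order_pos hq hqp
  set d := orderOf ((q : ZMod p) ^ 2) with hdd
  have hk : ((q : ZMod p) ^ (d * n)) ^ 2 = 1 := by
    rw [← pow_mul, mul_comm, pow_mul, pow_mul, pow_orderOf_eq_one, one_pow]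
  have h1 := frob_dvd hζ hη htop hq (d * n) hk y
  have hle : n ≤ q ^ (d * n) :=
    (Nat.le_mul_of_pos_left n hd).trans (Nat.lt_pow_self hq.one_lt).le
  have h2 : (q : 𝓞 F) ∣ y ^ (q ^ (d * n)) := by
    rw [← Ideal.mem_span_singleton]
    exact hJ (Ideal.pow_le_pow_right hle (Ideal.pow_mem_pow hy _))
  have := dvd_sub h2 h1
  simpa using this

lemma card_primesAt (hp2 : p ≠ 2) (hζ : IsPrimitiveRoot ζ p) {η : 𝓞 F}
    (hη : algebraMap F E η = ζ + ζ⁻¹) (htop : Algebra.adjoin ℚ {(η : F)} = ⊤)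
    {q : ℕ} (hq : q.Prime) (hqp : q ≠ p) :
    orderOf ((q : ZMod p) ^ 2) * (primesAt F q).card = (p - 1) / 2 := by
  classical
  have h0 : Ideal.span {(q : 𝓞 F)} ≠ 0 := by
    rw [Ne, Ideal.zero_eq_bot, Ideal.span_singleton_eq_bot]; exact_mod_cast hq.ne_zero
  have hnd := (UniqueFactorizationMonoid.squarefree_iff_nodup_normalizedFactors h0).1
    (span_squarefree hζ hη htop hq hqp)
  have hprod : ∏ P ∈ primesAt F q, P = Ideal.span {(q : 𝓞 F)} := by
    have e : (primesAt F q).val = UniqueFactorizationMonoid.normalizedFactors (Ideal.span {(q : 𝓞 F)}) := by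
      rw [primesAt, Multiset.toFinset_val]
      convert hnd.dedup
    rw [Finset.prod_eq_multiset_prod, e, Multiset.map_id']
    exact Ideal.prod_normalizedFactors_eq_self h0
  have h1 := congrArg Ideal.absNorm hprod
  rw [map_prod, absNorm_span_nat, finrank_F hp2 hζ hη htop, Finset.prod_congr rfl (fun P hP => by
    obtain ⟨hP1, hP2⟩ := (mem_primesAt hq.ne_zero).1 hP
    have := Ideal.isPrime_of_prime hP1
    exact absNorm_of_prime hζ hη htop hq hqp P hP2), Finset.prod_const, ← pow_mul] at h1
  exact Nat.pow_right_injective hq.two_le h1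

lemma local_prod {d m : ℕ} {w : ℂ} (hw : IsPrimitiveRoot w d) (hd : 0 < d) (X : ℂ) :
    ∏ j ∈ Finset.range (d * m), (1 - w ^ j * X) = (1 - X ^ d) ^ m := by
  have hbase : ∏ j ∈ Finset.range d, (1 - w ^ j * X) = 1 - X ^ d := by
    have := hw.pow_sub_pow_eq_prod_sub_mul 1 X hd
    rw [one_pow] at this
    rw [this]
    refine Finset.prod_nbij (fun j => w ^ j) ?_ ?_ ?_ ?_
    · intro j _
      rw [Polynomial.mem_nthRootsFinset hd, ← pow_mul, mul_comm, pow_mul, hw.pow_eq_one, one_pow]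
    · intro i hi j hj h
      exact hw.pow_inj (Finset.mem_range.1 hi) (Finset.mem_range.1 hj) h
    · intro x hx
      have hx' : x ^ d = 1 := (Polynomial.mem_nthRootsFinset hd _).1 hx
      have : NeZero d := ⟨hd.ne'⟩
      obtain ⟨i, hi, rfl⟩ := hw.eq_pow_of_pow_eq_one hx'
      exact ⟨i, Finset.mem_coe.2 (Finset.mem_range.2 hi), rfl⟩
    · intro j _; rfl
  induction m with
  | zero => simp
  | succ m ih =>
    rw [Nat.mul_succ, Finset.prod_range_add, ih, pow_succ, ← hbase]
    congr 1
    apply Finset.prod_congr rfl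
    intro j _
    rw [pow_add, pow_mul, hw.pow_eq_one, one_pow, one_mul]

/-- the prime above `p` -/
lemma primesAt_p (hp2 : p ≠ 2) (hζ : IsPrimitiveRoot ζ p) {η : 𝓞 F}
    (hη : algebraMap F E η = ζ + ζ⁻¹) (htop : Algebra.adjoin ℚ {(η : F)} = ⊤) :
    (Ideal.span {2 - η}) ^ ((p - 1) / 2) = Ideal.span {(p : 𝓞 F)} ∧
    Ideal.absNorm (Ideal.span {2 - η}) = p ∧ Prime (Ideal.span {2 - η}) ∧
    primesAt F p = {Ideal.span {2 - η}} := by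
  have hn : 0 < (p - 1) / 2 := by
    have := hpf.out.two_le
    omega
  have h1 : Associated ((2 - η) ^ ((p - 1) / 2)) (p : 𝓞 F) := by
    have hE : Associated (algebraMap (𝓞 F) (𝓞 E) ((2 - η) ^ ((p - 1) / 2)))
        (algebraMap (𝓞 F) (𝓞 E) (p : 𝓞 F)) := by
      rw [map_natCast, map_pow, map_sub, etaO_map hζ hη, map_ofNat]
      refine Associated.trans ?_ (IsCyclotomicExtension.Rat.associated_zeta_sub_one_pow_prime p hζ)
      have e : p - 1 = 2 * ((p - 1) / 2) := by
        have := hpf.out.odd_of_ne_two hp2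
        obtain ⟨k, hk⟩ := this
        omega
      rw [e, pow_mul, ← e]
      apply Associated.pow_pow
      have hzw := zw_one hζ
      refine ⟨-Units.mkOfMulEqOne _ _ hzw, ?_⟩
      simp only [Units.val_neg, Units.val_mkOfMulEqOne]
      linear_combination hzw
    exact associated_of_dvd_dvd (dvd_descent hE.dvd) (dvd_descent hE.symm.dvd)
  have h2 : (Ideal.span {2 - η}) ^ ((p - 1) / 2) = Ideal.span {(p : 𝓞 F)} := by
    rw [Ideal.span_singleton_pow, Ideal.span_singleton_eq_span_singleton]
    exact h1
  have h3 : Ideal.absNorm (Ideal.span {2 - η}) = p := by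
    have := congrArg Ideal.absNorm h2
    rw [map_pow, absNorm_span_nat, finrank_F hp2 hζ hη htop] at this
    exact Nat.pow_left_injective (by omega) this
  have h4 : (Ideal.span {2 - η}).IsPrime :=
    Ideal.isPrime_of_irreducible_absNorm (by rw [h3]; exact hpf.out)
  have h5 : Prime (Ideal.span {2 - η}) := by
    apply Ideal.prime_of_isPrime _ h4
    intro h
    rw [h, Ideal.absNorm_bot] at h3
    exact hpf.out.ne_zero h3.symm
  refine ⟨h2, h3, h5, ?_⟩
  ext P
  rw [mem_primesAt hpf.out.ne_zero, Finset.mem_singleton, ← Ideal.span_singleton_le_iff_mem,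
    ← Ideal.dvd_iff_le, ← h2]
  constructor
  · rintro ⟨hP, hd⟩
    exact associated_iff_eq.1 (hP.irreducible.associated_of_dvd h5.irreducible (hP.dvd_of_dvd_pow hd))
  · rintro rfl
    exact ⟨h5, dvd_pow_self _ hn.ne'⟩

end setup

/-- The data of a generator of the group of even characters. -/
structure CharData (p : ℕ) [Fact p.Prime] where
  g : (ZMod p)ˣ
  hg : ∀ x, x ∈ Subgroup.zpowers g
  ψ : DirichletCharacter ℂ p
  hω : IsPrimitiveRoot (ψ g) ((p - 1) / 2)
  heven : ψ (-1) = 1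
  hord : ∀ a : ZMod p, a ≠ 0 → orderOf (ψ a) = orderOf (a ^ 2)

lemma exists_charData (p : ℕ) [hpf : Fact p.Prime] (hp2 : p ≠ 2) : Nonempty (CharData p) := by
  obtain ⟨g, hg⟩ := IsCyclic.exists_generator (α := (ZMod p)ˣ)
  have hodd := hpf.out.odd_of_ne_two hp2
  have htwo := hpf.out.two_le
  have hcard : Fintype.card (ZMod p)ˣ = p - 1 := ZMod.card_units p
  have h0 : p - 1 ≠ 0 := by omega
  have hprim := Complex.isPrimitiveRoot_exp (p - 1) h0
  set w := Complex.exp (2 * ↑Real.pi * Complex.I / ↑(p - 1)) with hw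
  obtain ⟨u, hu⟩ : ∃ u : ℂˣ, (u : ℂ) = w := ⟨(hprim.isUnit h0).unit, rfl⟩
  have hmem : u ∈ rootsOfUnity (Fintype.card (ZMod p)ˣ) ℂ := by
    rw [hcard, mem_rootsOfUnity]
    apply Units.ext
    push_cast
    rw [hu, hprim.pow_eq_one]
  let χ : MulChar (ZMod p) ℂ := MulChar.ofRootOfUnity hmem hg
  have hχ : χ g = w := by rw [MulChar.ofRootOfUnity_spec, hu]
  have hog : orderOf (g : ZMod p) = p - 1 := by
    rw [orderOf_units, orderOf_eq_card_of_forall_mem_zpowers hg, Nat.card_eq_fintype_card, hcard]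
  refine ⟨⟨g, hg, χ ^ 2, ?_, ?_, ?_⟩⟩
  · rw [MulChar.pow_apply_coe, hχ]
    apply hprim.pow (by omega)
    obtain ⟨k, hk⟩ := hodd
    omega
  · rw [MulChar.pow_apply' _ two_ne_zero, ← map_pow]
    simp
  · intro a ha
    obtain ⟨k, hk⟩ := (mem_powers_iff_mem_zpowers).2 (hg (Units.mk0 a ha))
    have hk' : a = (g : ZMod p) ^ k := by
      have := congrArg Units.val hk
      simpa using this.symm
    rw [MulChar.pow_apply' _ two_ne_zero, hk', map_pow, hχ, ← pow_mul, ← pow_mul,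
      IsOfFinOrder.orderOf_pow _ _ (isOfFinOrder_iff_pow_eq_one.2 ⟨p - 1, by omega, hprim.pow_eq_one⟩),
      IsOfFinOrder.orderOf_pow _ _ (isOfFinOrder_iff_pow_eq_one.2
        ⟨p - 1, by omega, ZMod.pow_card_sub_one_eq_one g.ne_zero⟩), hog, ← hprim.eq_orderOf]

lemma exists_prime_mem {R : Type*} [CommRing R] (P : Ideal R) [hP : P.IsPrime] (n : ℕ) (hn : n ≠ 0)
    (h : (n : R) ∈ P) : ∃ q : ℕ, q.Prime ∧ (q : R) ∈ P := by
  induction n using Nat.strong_induction_on with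
  | _ n ih =>
    by_cases h1 : n = 1
    · subst h1
      exact absurd ((Ideal.eq_top_iff_one P).2 (by simpa using h)) hP.ne_top
    · have hm := Nat.minFac_prime h1
      obtain ⟨k, hk⟩ := Nat.minFac_dvd n
      have hk0 : k ≠ 0 := by rintro rfl; exact hn (by simpa using hk)
      have h' : ((n.minFac : R) * (k : R)) ∈ P := by
        rw [← Nat.cast_mul, ← hk]; exact h
      rcases hP.mem_or_mem h' with h2 | h2
      · exact ⟨_, hm, h2⟩
      · refine ih k ?_ hk0 h2
        have := hm.two_le
        nlinarith [Nat.pos_of_ne_zero hk0]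

section setup
variable {p : ℕ} [hpf : Fact p.Prime] {F E : Type*} [Field F] [NumberField F] [Field E]
  [NumberField E] [Algebra F E] [hcyc : IsCyclotomicExtension {p} ℚ E] {ζ : E}

lemma local_factor (hp2 : p ≠ 2) (hζ : IsPrimitiveRoot ζ p) {η : 𝓞 F}
    (hη : algebraMap F E η = ζ + ζ⁻¹) (htop : Algebra.adjoin ℚ {(η : F)} = ⊤)
    (D : CharData p) {s : ℝ} {q : ℕ} (hq : q.Prime) :
    ((∏ P ∈ primesAt F q, (1 - (Ideal.absNorm P : ℝ) ^ (-s))⁻¹ : ℝ) : ℂ) =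
      (1 - (q : ℂ) ^ (-(s : ℂ)))⁻¹ *
        ∏ j ∈ Finset.Ico 1 ((p - 1) / 2), (1 - (D.ψ ^ j) (q : ZMod p) * (q : ℂ) ^ (-(s : ℂ)))⁻¹ := by
  have hqs : ((q : ℂ) ^ (-(s : ℂ))) = (((q : ℝ) ^ (-s) : ℝ) : ℂ) := by
    rw [Complex.ofReal_cpow (Nat.cast_nonneg q)]; push_cast; rfl
  by_cases hqp : q = p
  · subst hqp
    obtain ⟨-, h2, -, h4⟩ := primesAt_p hp2 hζ hη htop
    rw [h4, Finset.prod_singleton, h2, Finset.prod_eq_one, hqs]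
    · push_cast; ring
    · intro j hj
      rw [MulChar.pow_apply' _ (by have := (Finset.mem_Ico.1 hj).1; omega)]
      have : D.ψ ((q : ℕ) : ZMod q) = 0 := by
        rw [ZMod.natCast_self]
        exact MulChar.map_zero _
      rw [this, zero_pow (by have := (Finset.mem_Ico.1 hj).1; omega)]
      simp
  · have hq0 : (q : ZMod p) ≠ 0 := by
      rw [Ne, ZMod.natCast_eq_zero_iff, Nat.prime_dvd_prime_iff_eq hpf.out hq]
      exact fun h => hqp h.symm
    have hcard := card_primesAt hp2 hζ hη htop hq hqp
    have hdpos := order_pos (p := p) hq hqp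
    set d := orderOf ((q : ZMod p) ^ 2) with hd
    set m := (primesAt F q).card with hm
    have hprim : IsPrimitiveRoot (D.ψ (q : ZMod p)) d := by
      rw [hd, ← D.hord _ hq0]
      exact IsPrimitiveRoot.orderOf _
    have hn : 0 < (p - 1) / 2 := by
      have := hpf.out.two_le
      omega
    have hR : (1 - (q : ℂ) ^ (-(s : ℂ)))⁻¹ *
        ∏ j ∈ Finset.Ico 1 ((p - 1) / 2), (1 - (D.ψ ^ j) (q : ZMod p) * (q : ℂ) ^ (-(s : ℂ)))⁻¹
        = (∏ j ∈ Finset.range (d * m), (1 - (D.ψ (q : ZMod p)) ^ j * (q : ℂ) ^ (-(s : ℂ))))⁻¹ := by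
      rw [hcard, Finset.range_eq_Ico, Finset.prod_eq_prod_Ico_succ_bot hn, mul_inv, Finset.prod_inv_distrib]
      congr 1
      · simp
      · congr 1
        apply Finset.prod_congr rfl
        intro j hj
        rw [MulChar.pow_apply' _ (by have := (Finset.mem_Ico.1 hj).1; omega)]
    rw [hR, local_prod hprim hdpos, Finset.prod_congr rfl (fun P hP => by
      obtain ⟨hP1, hP2⟩ := (mem_primesAt hq.ne_zero).1 hP
      have := Ideal.isPrime_of_prime hP1
      rw [absNorm_of_prime hζ hη htop hq hqp P hP2]), Finset.prod_const, hqs]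
    have hr : (((q ^ d : ℕ) : ℝ) ^ (-s)) = ((q : ℝ) ^ (-s)) ^ d := by
      rw [Real.rpow_pow_comm (Nat.cast_nonneg q)]; push_cast; rfl
    rw [hr, inv_pow]
    push_cast
    rfl

lemma dedekind_factor (hp2 : p ≠ 2) (hζ : IsPrimitiveRoot ζ p) {η : 𝓞 F}
    (hη : algebraMap F E η = ζ + ζ⁻¹) (htop : Algebra.adjoin ℚ {(η : F)} = ⊤)
    (D : CharData p) {s : ℝ} (hs : 1 < s) (hne : dedekindZeta F s ≠ 0) :
    dedekindZeta F s = riemannZeta s *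
      ∏ j ∈ Finset.Ico 1 ((p - 1) / 2), DirichletCharacter.LFunction (D.ψ ^ j) s := by
  classical
  have hs' : 1 < (s : ℂ).re := by simpa using hs
  let S : ℕ → Finset (Ideal (𝓞 F)) := fun N => N.primesBelow.biUnion (primesAt F)
  have hS : ∀ N, ∀ P ∈ S N, Prime P := by
    intro N P hP
    obtain ⟨q, hq, hPq⟩ := Finset.mem_biUnion.1 hP
    exact ((mem_primesAt (Nat.prime_of_mem_primesBelow hq).ne_zero).1 hPq).1
  have hev : ∀ P, Prime P → ∀ᶠ N in atTop, P ∈ S N := by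
    intro P hP
    have hPp := Ideal.isPrime_of_prime hP
    have hex : ∃ q : ℕ, q.Prime ∧ (q : 𝓞 F) ∈ P := by
      have hmem := Ideal.absNorm_mem P
      have hne0 : Ideal.absNorm P ≠ 0 := by
        rw [Ne, Ideal.absNorm_eq_zero_iff]; exact hP.ne_zero
      exact exists_prime_mem P (Ideal.absNorm P) hne0 hmem
    obtain ⟨q, hq, hqP⟩ := hex
    filter_upwards [eventually_gt_atTop q] with N hN
    exact Finset.mem_biUnion.2 ⟨q, Nat.mem_primesBelow.2 ⟨hN, hq⟩, (mem_primesAt hq.ne_zero).2 ⟨hP, hqP⟩⟩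
  obtain ⟨Z, hZ, hlim⟩ := ded_euler F s hs hne S hS hev
  have hdisj : ∀ N : ℕ, (N.primesBelow : Set ℕ).PairwiseDisjoint (primesAt F) := by
    intro N q hq r hr hqr
    have hq' := Nat.prime_of_mem_primesBelow (Finset.mem_coe.1 hq)
    have hr' := Nat.prime_of_mem_primesBelow (Finset.mem_coe.1 hr)
    rw [Function.onFun, Finset.disjoint_left]
    intro P hP1 hP2
    obtain ⟨hP, h1⟩ := (mem_primesAt hq'.ne_zero).1 hP1
    obtain ⟨-, h2⟩ := (mem_primesAt hr'.ne_zero).1 hP2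
    have hPp := Ideal.isPrime_of_prime hP
    have hcop : IsCoprime (q : ℤ) (r : ℤ) := by
      rw [Nat.isCoprime_iff_coprime]
      exact (Nat.coprime_primes hq' hr').2 hqr
    obtain ⟨a, b, hab⟩ := hcop
    have h5 : (1 : 𝓞 F) = (a : 𝓞 F) * q + b * r := by
      exact_mod_cast congrArg (Int.cast (R := 𝓞 F)) hab.symm
    exact hPp.ne_top ((Ideal.eq_top_iff_one P).2
      (h5 ▸ P.add_mem (P.mul_mem_left _ h1) (P.mul_mem_left _ h2)))
  have hlim2 : Tendsto (fun N : ℕ => ∏ q ∈ N.primesBelow, ((1 - (q : ℂ) ^ (-(s : ℂ)))⁻¹ *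
        ∏ j ∈ Finset.Ico 1 ((p - 1) / 2), (1 - (D.ψ ^ j) (q : ZMod p) * (q : ℂ) ^ (-(s : ℂ)))⁻¹))
      atTop (𝓝 (Z : ℂ)) := by
    have := (Complex.continuous_ofReal.tendsto Z).comp hlim
    refine this.congr fun N => ?_
    simp only [Function.comp, S]
    rw [Finset.prod_biUnion (hdisj N), Complex.ofReal_prod]
    apply Finset.prod_congr rfl
    intro q hq
    exact local_factor hp2 hζ hη htop D (Nat.prime_of_mem_primesBelow hq)
  have hlim3 : Tendsto (fun N : ℕ => ∏ q ∈ N.primesBelow, ((1 - (q : ℂ) ^ (-(s : ℂ)))⁻¹ *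
        ∏ j ∈ Finset.Ico 1 ((p - 1) / 2), (1 - (D.ψ ^ j) (q : ZMod p) * (q : ℂ) ^ (-(s : ℂ)))⁻¹))
      atTop (𝓝 (riemannZeta s *
      ∏ j ∈ Finset.Ico 1 ((p - 1) / 2), DirichletCharacter.LFunction (D.ψ ^ j) s)) := by
    simp_rw [Finset.prod_mul_distrib]
    refine (riemannZeta_eulerProduct hs').mul ?_
    have : ∀ N : ℕ, ∏ q ∈ N.primesBelow, ∏ j ∈ Finset.Ico 1 ((p - 1) / 2),
        (1 - (D.ψ ^ j) (q : ZMod p) * (q : ℂ) ^ (-(s : ℂ)))⁻¹ =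
        ∏ j ∈ Finset.Ico 1 ((p - 1) / 2), ∏ q ∈ N.primesBelow,
        (1 - (D.ψ ^ j) (q : ZMod p) * (q : ℂ) ^ (-(s : ℂ)))⁻¹ := fun N => Finset.prod_comm
    simp_rw [this]
    apply tendsto_finsetProd
    intro j _
    rw [DirichletCharacter.LFunction_eq_LSeries _ hs']
    exact DirichletCharacter.LSeries_eulerProduct _ hs'
  rw [← hZ]
  exact tendsto_nhds_unique hlim2 hlim3

lemma psi_pow_ne_one (D : CharData p) {j : ℕ} (hj : j ∈ Finset.Ico 1 ((p - 1) / 2)) :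
    D.ψ ^ j ≠ 1 := by
  rw [Finset.mem_Ico] at hj
  intro h
  have h1 : (D.ψ ^ j) D.g = 1 := by rw [h]; exact MulChar.one_apply_coe _
  rw [MulChar.pow_apply_coe] at h1
  exact D.hω.pow_ne_one_of_pos_of_lt (by omega) hj.2 h1

lemma residue_eq (hp2 : p ≠ 2) (hζ : IsPrimitiveRoot ζ p) {η : 𝓞 F}
    (hη : algebraMap F E η = ζ + ζ⁻¹) (htop : Algebra.adjoin ℚ {(η : F)} = ⊤)
    (D : CharData p) :
    (dedekindZeta_residue F : ℂ) =
      ∏ j ∈ Finset.Ico 1 ((p - 1) / 2), DirichletCharacter.LFunction (D.ψ ^ j) 1 := by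
  have h1 := tendsto_sub_one_mul_dedekindZeta_nhdsGT F
  have hne : (dedekindZeta_residue F : ℂ) ≠ 0 := by
    exact_mod_cast dedekindZeta_residue_ne_zero F
  have hev : ∀ᶠ s : ℝ in 𝓝[>] 1, dedekindZeta F s ≠ 0 := by
    filter_upwards [h1.eventually_ne hne] with s hs h
    exact hs (by rw [h, mul_zero])
  have hof : Tendsto (fun s : ℝ => (s : ℂ)) (𝓝[>] 1) (𝓝[≠] 1) := by
    apply tendsto_nhdsWithin_of_tendsto_nhds_of_eventually_within
    · have : Tendsto (fun s : ℝ => (s : ℂ)) (𝓝 1) (𝓝 ((1 : ℝ) : ℂ)) := Complex.continuous_ofReal.tendsto 1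
      rw [Complex.ofReal_one] at this
      exact this.mono_left nhdsWithin_le_nhds
    · filter_upwards [self_mem_nhdsWithin] with s hs
      intro h
      have : s = 1 := by exact_mod_cast (Set.mem_singleton_iff.1 h)
      exact (ne_of_gt hs) this
  have h2 : Tendsto (fun s : ℝ => ((s : ℂ) - 1) * riemannZeta s *
      ∏ j ∈ Finset.Ico 1 ((p - 1) / 2), DirichletCharacter.LFunction (D.ψ ^ j) s) (𝓝[>] 1)
      (𝓝 (1 * ∏ j ∈ Finset.Ico 1 ((p - 1) / 2), DirichletCharacter.LFunction (D.ψ ^ j) 1)) := by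
    refine (riemannZeta_residue_one.comp hof).mul ?_
    apply tendsto_finsetProd
    intro j hj
    have hc := (DirichletCharacter.differentiable_LFunction (psi_pow_ne_one D hj)).continuous.tendsto 1
    exact hc.comp (hof.mono_right nhdsWithin_le_nhds)
  rw [one_mul] at h2
  refine tendsto_nhds_unique h1 (h2.congr' ?_)
  filter_upwards [hev, self_mem_nhdsWithin] with s hs hs1
  rw [dedekind_factor hp2 hζ hη htop D hs1 hs, mul_assoc]

end setup

lemma sum_periodic_shift {M : Type*} [AddCommGroup M] (n : ℕ) (f : ℕ → M) (hf : ∀ c, f (c + n) = f c)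
    (i : ℕ) : ∑ c ∈ Finset.range n, f (c + i) = ∑ c ∈ Finset.range n, f c := by
  induction i with
  | zero => simp
  | succ i ih =>
    have h1 := Finset.sum_range_succ' (fun c => f (c + i)) n
    have h2 := Finset.sum_range_succ (fun c => f (c + i)) n
    rw [h1] at h2
    simp only [zero_add] at h2
    rw [show n + i = i + n by ring, hf] at h2
    rw [← ih, ← add_right_cancel h2]
    apply Finset.sum_congr rfl
    intro c _
    congr 1; ring

lemma det_circ (m : ℕ) (ω : ℂ) (hω : IsPrimitiveRoot ω (m + 1)) (ℓ : ℕ → ℝ)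
    (hℓ : ∀ c, ℓ (c + (m + 1)) = ℓ c) (M : Matrix (Fin (m + 1)) (Fin (m + 1)) ℝ)
    (hM0 : ∀ c, M 0 c = 1)
    (hM : ∀ i c : Fin (m + 1), i ≠ 0 → M i c = 2 * (ℓ (i + c) - ℓ c)) :
    |M.det| = (m + 1) * ∏ j ∈ Finset.Ico 1 (m + 1),
      ‖2 * ∑ c ∈ Finset.range (m + 1), (ℓ c : ℂ) * ω ^ (j * c)‖ := by
  classical
  set S : ℕ → ℂ := fun j => ∑ c ∈ Finset.range (m + 1), (ℓ c : ℂ) * ω ^ (j * c) with hS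
  have hn : ‖ω‖ = 1 := hω.norm'_eq_one (by omega)
  have hωc : ω * (starRingEnd ℂ) ω = 1 := by
    rw [Complex.mul_conj, Complex.normSq_eq_norm_sq, hn]; simp
  set ω' := (starRingEnd ℂ) ω with hω'
  let V : Matrix (Fin (m + 1)) (Fin (m + 1)) ℂ := Matrix.vandermonde (fun c : Fin (m + 1) => ω ^ (c : ℕ))
  let V' : Matrix (Fin (m + 1)) (Fin (m + 1)) ℂ := V.map (starRingEnd ℂ)
  have hV : ∀ c j, V c j = ω ^ ((j : ℕ) * c) := by
    intro c j
    simp [V, Matrix.vandermonde, ← pow_mul, mul_comm]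
  have hV' : ∀ c j, V' c j = ω' ^ ((c : ℕ) * j) := by
    intro c j
    simp [V', hV, hω', mul_comm]
  have hdetV : V.det ≠ 0 := by
    rw [Matrix.det_vandermonde_ne_zero_iff]
    intro a b h
    exact Fin.ext (hω.pow_inj a.2 b.2 h)
  have hdetV' : ‖V'.det‖ = ‖V.det‖ := by
    have : V'.det = (starRingEnd ℂ) V.det := by
      rw [RingHom.map_det]; rfl
    rw [this]; exact Complex.norm_conj _
  let B : Matrix (Fin (m + 1)) (Fin (m + 1)) ℂ :=
    Matrix.of fun i j => if i = 0 then 1 else ω' ^ ((i : ℕ) * j) - 1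
  let A : Matrix (Fin (m + 1)) (Fin (m + 1)) ℂ :=
    Matrix.of fun i j => if i = 0 then (if j = 0 then 1 else 0) else ω' ^ ((i : ℕ) * j) - 1
  let d : Fin (m + 1) → ℂ := fun j => if j = 0 then (m + 1) else 2 * S j
  have hB : B.det = V'.det := by
    refine Matrix.det_eq_of_forall_row_eq_smul_add_const (fun i => if i = 0 then 0 else -1) 0 (by simp) ?_
    intro i j
    rw [hV', hV']
    by_cases hi : i = 0
    · simp [B, hi]
    · simp [B, hi, sub_eq_add_neg]
  have hAB : A.det = B.det := by
    rw [Matrix.det_succ_column_zero, Matrix.det_succ_column_zero]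
    apply Finset.sum_congr rfl
    intro i _
    by_cases hi : i = 0
    · subst hi
      have : A.submatrix (Fin.succAbove 0) Fin.succ = B.submatrix (Fin.succAbove 0) Fin.succ := by
        ext a b
        simp [A, B]
      rw [this]
      simp [A, B]
    · simp [A, B, hi]
  have key : (M.map (algebraMap ℝ ℂ)) * V = A * Matrix.diagonal d := by
    ext i j
    rw [Matrix.mul_diagonal, Matrix.mul_apply]
    simp only [hV, Matrix.map_apply]
    by_cases hi : i = 0
    · subst hi
      simp only [hM0, map_one, one_mul]
      rw [Fin.sum_univ_eq_sum_range (fun c => ω ^ ((j : ℕ) * c))]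
      by_cases hj : j = 0
      · subst hj; simp [A, d]
      · have hj' : (j : ℕ) ≠ 0 := fun h => hj (Fin.ext h)
        simp only [A, d, Matrix.of_apply, if_pos, if_neg hj, zero_mul]
        simp only [pow_mul]
        have hne : ω ^ (j : ℕ) ≠ 1 := hω.pow_ne_one_of_pos_of_lt hj' j.2
        have := mul_neg_geom_sum (ω ^ (j : ℕ)) (m + 1)
        rw [← pow_mul, mul_comm (j : ℕ), pow_mul, hω.pow_eq_one, one_pow, sub_self] at this
        exact (mul_eq_zero.1 this).resolve_left (sub_ne_zero.2 (Ne.symm hne))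
    · have h1 : ∑ c : Fin (m + 1), (algebraMap ℝ ℂ) (M i c) * ω ^ ((j : ℕ) * c)
          = 2 * (ω' ^ ((i : ℕ) * j) - 1) * S j := by
        have e1 : ∀ c : Fin (m + 1), (algebraMap ℝ ℂ) (M i c) * ω ^ ((j : ℕ) * c) =
            2 * (ω' ^ ((i : ℕ) * j) * ((ℓ (c + i) : ℂ) * ω ^ ((j : ℕ) * (c + i))) - (ℓ c : ℂ) * ω ^ ((j : ℕ) * c)) := by
          intro c
          rw [hM i c hi]
          have : ω' ^ ((i : ℕ) * j) * ω ^ ((j : ℕ) * (c + i)) = ω ^ ((j : ℕ) * c) := by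
            rw [mul_add, pow_add, mul_comm (i : ℕ), mul_comm, mul_assoc, ← mul_pow, hωc]
            simp
          rw [mul_left_comm (ω' ^ ((i : ℕ) * j)), this, add_comm (c : ℕ)]
          simp only [Complex.coe_algebraMap]
          push_cast
          ring
        rw [Finset.sum_congr rfl (fun c _ => e1 c), ← Finset.mul_sum, Finset.sum_sub_distrib,
          ← Finset.mul_sum, Fin.sum_univ_eq_sum_range (fun c => (ℓ (c + i) : ℂ) * ω ^ ((j : ℕ) * (c + i))),
          Fin.sum_univ_eq_sum_range (fun c => (ℓ c : ℂ) * ω ^ ((j : ℕ) * c)),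
          sum_periodic_shift (m + 1) (fun c => (ℓ c : ℂ) * ω ^ ((j : ℕ) * c))]
        · simp only [hS]; ring
        · intro c
          simp only [hℓ]
          rw [mul_add, pow_add, mul_comm (j : ℕ) (m + 1), pow_mul ω (m + 1), hω.pow_eq_one]
          simp
      rw [h1]
      by_cases hj : j = 0
      · subst hj; simp [A, hi]
      · simp only [A, d, Matrix.of_apply, if_neg hi, if_neg hj]; ring
  have hdet := congrArg Matrix.det key
  rw [Matrix.det_mul, Matrix.det_mul, Matrix.det_diagonal, hAB, hB] at hdet
  have hMdet : (M.map (algebraMap ℝ ℂ)).det = (M.det : ℂ) := by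
    have := RingHom.map_det (algebraMap ℝ ℂ) M
    rw [← RingHom.mapMatrix_apply, ← this]; rfl
  rw [hMdet] at hdet
  have hnorm := congrArg norm hdet
  rw [norm_mul, norm_mul, hdetV', mul_comm, Complex.norm_real] at hnorm
  have := mul_left_cancel₀ (norm_ne_zero_iff.2 hdetV) hnorm
  rw [← Real.norm_eq_abs, this, Fin.prod_univ_succ, norm_mul, norm_prod]
  congr 1
  · simp only [d, if_pos]
    exact_mod_cast Complex.norm_natCast (m + 1)
  · rw [Finset.prod_Ico_eq_prod_range, Nat.add_sub_cancel, ← Fin.prod_univ_eq_prod_range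
      (fun j => ‖2 * ∑ c ∈ Finset.range (m + 1), (ℓ c : ℂ) * ω ^ ((1 + j) * c)‖)]
    apply Finset.prod_congr rfl
    intro j _
    simp only [d, Fin.succ_ne_zero, if_false, hS, Fin.val_succ, add_comm 1]

section setup
variable {p : ℕ} [hpf : Fact p.Prime] {F E : Type*} [Field F] [NumberField F] [Field E]
  [NumberField E] [Algebra F E] [hcyc : IsCyclotomicExtension {p} ℚ E] {ζ : E}

lemma stdAddChar_neg_mul (a : ZMod p) : ZMod.stdAddChar a * ZMod.stdAddChar (-a) = (1 : ℂ) := by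
  rw [← AddChar.map_add_eq_mul, add_neg_cancel, AddChar.map_zero_eq_one]

lemma stdAddChar_conj (a : ZMod p) :
    (starRingEnd ℂ) (ZMod.stdAddChar a) = ZMod.stdAddChar (-a) := by
  exact (AddChar.map_neg_eq_conj _ _).symm

lemma stdAddChar_prim (a : ZMod p) (ha : a ≠ 0) : IsPrimitiveRoot (ZMod.stdAddChar a : ℂ) p := by
  rw [IsPrimitiveRoot.iff_orderOf]
  apply orderOf_eq_prime
  · rw [← AddChar.map_nsmul_eq_pow]; simp
  · intro h
    apply ha
    apply ZMod.injective_stdAddChar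
    rw [h, AddChar.map_zero_eq_one]

lemma exists_emb (hζ : IsPrimitiveRoot ζ p) (a : ZMod p) (ha : a ≠ 0) :
    ∃ φ : E →+* ℂ, φ ζ = ZMod.stdAddChar a := by
  have hirr := Polynomial.cyclotomic.irreducible_rat hpf.out.pos
  let e := hζ.embeddingsEquivPrimitiveRoots ℂ hirr
  refine ⟨(e.symm ⟨_, (mem_primitiveRoots hpf.out.pos).2 (stdAddChar_prim a ha)⟩).toRingHom, ?_⟩
  have h := hζ.embeddingsEquivPrimitiveRoots_apply_coe ℂ hirr (e.symm ⟨_, (mem_primitiveRoots hpf.out.pos).2 (stdAddChar_prim a ha)⟩)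
  rw [Equiv.apply_symm_apply] at h
  exact h.symm

lemma orderOf_g (D : CharData p) : orderOf (D.g : ZMod p) = p - 1 := by
  rw [orderOf_units, orderOf_eq_card_of_forall_mem_zpowers D.hg, Nat.card_eq_fintype_card,
    ZMod.card_units p]

lemma g_half_inj (hp2 : p ≠ 2) (D : CharData p) (i j : ℕ) (hi : i < (p - 1) / 2) (hj : j < (p - 1) / 2)
    (h : (D.g : ZMod p) ^ i = (D.g : ZMod p) ^ j ∨ (D.g : ZMod p) ^ i = -(D.g : ZMod p) ^ j) : i = j := by
  have h2 : (D.g : ZMod p) ^ (2 * i) = (D.g : ZMod p) ^ (2 * j) := by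
    rw [mul_comm, pow_mul, mul_comm, pow_mul]
    rcases h with h | h <;> rw [h]; ring
  have ho := orderOf_g D
  have := pow_injOn_Iio_orderOf (x := (D.g : ZMod p)) (by rw [ho]; simp; omega) (by rw [ho]; simp; omega) h2
  omega

lemma stdAddChar_sum_eq (a b : ZMod p) (h : (ZMod.stdAddChar a + ZMod.stdAddChar (-a) : ℂ) =
    ZMod.stdAddChar b + ZMod.stdAddChar (-b)) : a = b ∨ a = -b := by
  have ha := stdAddChar_neg_mul a
  have hb := stdAddChar_neg_mul b
  have : (ZMod.stdAddChar a - ZMod.stdAddChar b : ℂ) * (ZMod.stdAddChar a - ZMod.stdAddChar (-b)) = 0 := by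
    linear_combination (ZMod.stdAddChar a : ℂ) * h - ha + hb
  rcases mul_eq_zero.1 this with h | h
  · left; exact ZMod.injective_stdAddChar (sub_eq_zero.1 h)
  · right; exact ZMod.injective_stdAddChar (sub_eq_zero.1 h)

lemma exists_places (hp2 : p ≠ 2) (hζ : IsPrimitiveRoot ζ p) {η : 𝓞 F}
    (hη : algebraMap F E η = ζ + ζ⁻¹) (htop : Algebra.adjoin ℚ {(η : F)} = ⊤)
    (D : CharData p) :
    InfinitePlace.nrRealPlaces F = (p - 1) / 2 ∧ InfinitePlace.nrComplexPlaces F = 0 ∧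
    (∀ w : InfinitePlace F, w.mult = 1) ∧
    ∃ b : Fin ((p - 1) / 2) ≃ InfinitePlace F, ∀ (c : Fin ((p - 1) / 2)) (k : ℕ),
      b c (2 - etaR (η : F) k) =
        ‖1 - (ZMod.stdAddChar ((k : ZMod p) * (D.g : ZMod p) ^ (c : ℕ)) : ℂ)‖ ^ 2 := by
  classical
  have hg0 : ∀ c : ℕ, (D.g : ZMod p) ^ c ≠ 0 := fun c => pow_ne_zero _ D.g.ne_zero
  choose φ hφ using fun c : ℕ => exists_emb hζ ((D.g : ZMod p) ^ c) (hg0 c)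
  let f : ℕ → F →+* ℂ := fun c => (φ c).comp (algebraMap F E)
  have hf : ∀ c, f c η = ZMod.stdAddChar ((D.g : ZMod p) ^ c) + ZMod.stdAddChar (-(D.g : ZMod p) ^ c) := by
    intro c
    simp only [f, RingHom.comp_apply, hη, map_add, map_inv₀, hφ]
    congr 1
    exact inv_eq_of_mul_eq_one_right (stdAddChar_neg_mul _)
  have hext : ∀ (f₁ f₂ : F →+* ℂ), f₁ η = f₂ η → f₁ = f₂ := by
    intro f₁ f₂ h
    have := algHom_eq_of_top htop f₁.toRatAlgHom f₂.toRatAlgHom (by simpa using h)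
    ext x
    exact DFunLike.congr_fun this x
  have hconj : ∀ c, ComplexEmbedding.conjugate (f c) = f c := by
    intro c
    apply hext
    rw [ComplexEmbedding.conjugate_coe_eq, hf, map_add, stdAddChar_conj, stdAddChar_conj, neg_neg,
      add_comm]
  let w : Fin ((p - 1) / 2) → InfinitePlace F := fun c => InfinitePlace.mk (f c)
  have hinj : Function.Injective w := by
    intro i j hij
    have h1 : f i = f j := by
      rcases InfinitePlace.mk_eq_iff.1 hij with h | h
      · exact h
      · rw [← h, hconj]
    have h2 := congrArg (fun f => f (η : F)) h1
    simp only [hf] at h2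
    exact Fin.ext (g_half_inj hp2 D i j i.2 j.2 (stdAddChar_sum_eq _ _ h2))
  have hreal : ∀ c, (w c).IsReal := by
    intro c
    rw [InfinitePlace.isReal_mk_iff]
    exact hconj c
  have hrk := InfinitePlace.card_add_two_mul_card_eq_rank F
  rw [finrank_F hp2 hζ hη htop] at hrk
  have hle : (p - 1) / 2 ≤ InfinitePlace.nrRealPlaces F := by
    have := Fintype.card_le_of_injective (fun c => (⟨w c, hreal c⟩ : {w : InfinitePlace F // w.IsReal}))
      (fun i j h => hinj (congrArg Subtype.val h))
    simpa using this
  have hc0 : InfinitePlace.nrComplexPlaces F = 0 := by omega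
  have hr0 : InfinitePlace.nrRealPlaces F = (p - 1) / 2 := by omega
  have hcard : Fintype.card (InfinitePlace F) = (p - 1) / 2 := by
    rw [InfinitePlace.card_eq_nrRealPlaces_add_nrComplexPlaces, hc0, hr0, add_zero]
  have hbij : Function.Bijective w := by
    rw [Fintype.bijective_iff_injective_and_card]
    exact ⟨hinj, by simp [hcard]⟩
  refine ⟨hr0, hc0, ?_, Equiv.ofBijective w hbij, ?_⟩
  · intro v
    obtain ⟨c, rfl⟩ := hbij.2 v
    exact InfinitePlace.mult_isReal ⟨w c, hreal c⟩
  · intro c k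
    simp only [Equiv.ofBijective_apply, w, InfinitePlace.apply]
    rw [map_sub, etaR_map, hf, etaR_eq _ _ (stdAddChar_neg_mul _), ← AddChar.map_nsmul_eq_pow,
      ← AddChar.map_nsmul_eq_pow, nsmul_eq_mul, nsmul_eq_mul, map_ofNat]
    set a := (k : ZMod p) * (D.g : ZMod p) ^ (c : ℕ)
    rw [mul_neg]
    have h1 : (2 - (ZMod.stdAddChar a + ZMod.stdAddChar (-a)) : ℂ) =
      (1 - ZMod.stdAddChar a) * (starRingEnd ℂ) (1 - ZMod.stdAddChar a) := by
      rw [map_sub, map_one, stdAddChar_conj]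
      linear_combination -stdAddChar_neg_mul a
    rw [h1, norm_mul, Complex.norm_conj, sq]
end setup

section setup
variable {p : ℕ} [hpf : Fact p.Prime] {F E : Type*} [Field F] [NumberField F] [Field E]
  [NumberField E] [Algebra F E] [hcyc : IsCyclotomicExtension {p} ℚ E] {ζ : E}

lemma N_map (hζ : IsPrimitiveRoot ζ p) {η : 𝓞 F}
    (hη : algebraMap F E η = ζ + ζ⁻¹) (k : ℕ) :
    algebraMap (𝓞 F) (𝓞 E) (2 - etaR η k) =
      (1 - hζ.toInteger ^ k) * (1 - hζ.inv.toInteger ^ k) := by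
  rw [map_sub, etaR_map, etaO_map hζ hη, etaR_eq _ _ (zw_one hζ), map_ofNat]
  have : hζ.toInteger ^ k * hζ.inv.toInteger ^ k = 1 := by rw [← mul_pow, zw_one hζ, one_pow]
  linear_combination -this

lemma N_assoc (hζ : IsPrimitiveRoot ζ p) {η : 𝓞 F}
    (hη : algebraMap F E η = ζ + ζ⁻¹) (k : ℕ) (hk : (k : ZMod p) ≠ 0) :
    Associated (2 - η) (2 - etaR η k) := by
  have h1 : (2 - η : 𝓞 F) = 2 - etaR η 1 := by simp [etaR]
  have e1 : algebraMap (𝓞 F) (𝓞 E) (2 - η) = (1 - hζ.toInteger) * (1 - hζ.inv.toInteger) := by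
    rw [h1, N_map hζ hη]; simp
  apply associated_of_dvd_dvd
  · apply dvd_descent (E := E)
    rw [e1, N_map hζ hη]
    refine mul_dvd_mul ?_ ?_
    · simpa using sub_dvd_pow_sub_pow 1 hζ.toInteger k
    · simpa using sub_dvd_pow_sub_pow 1 hζ.inv.toInteger k
  · apply dvd_descent (E := E)
    obtain ⟨k', hk'⟩ : ∃ k' : ℕ, ((k * k' : ℕ) : ZMod p) = (1 : ℕ) := by
      refine ⟨((k : ZMod p)⁻¹).val, ?_⟩
      push_cast
      rw [ZMod.natCast_zmod_val, mul_inv_cancel₀ hk]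
    rw [e1, N_map hζ hη]
    have a1 : hζ.toInteger = (hζ.toInteger ^ k) ^ k' := by
      rw [← pow_mul, zpow_congr hζ hk', pow_one]
    have a2 : hζ.inv.toInteger = (hζ.inv.toInteger ^ k) ^ k' := by
      rw [← pow_mul, zpow_congr hζ.inv hk', pow_one]
    refine mul_dvd_mul ?_ ?_
    · conv_rhs => rw [a1]
      simpa using sub_dvd_pow_sub_pow 1 (hζ.toInteger ^ k) k'
    · conv_rhs => rw [a2]
      simpa using sub_dvd_pow_sub_pow 1 (hζ.inv.toInteger ^ k) k'

/-- The elements `(1 - ζ ^ (g ^ c)) (1 - ζ ^ (- g ^ c))`. -/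
noncomputable def NG (D : CharData p) (η : 𝓞 F) (c : ℕ) : 𝓞 F :=
  2 - etaR η ((D.g : ZMod p) ^ c).val

lemma NG_zero (D : CharData p) (η : 𝓞 F) : NG D η 0 = 2 - η := by
  have : Fact (1 < p) := ⟨hpf.out.one_lt⟩
  simp [NG, ZMod.val_one, etaR]

lemma NG_coe (D : CharData p) (η : 𝓞 F) (i : ℕ) :
    ((NG D η i : 𝓞 F) : F) = 2 - etaR (η : F) ((D.g : ZMod p) ^ i).val := by
  change algebraMap (𝓞 F) F (2 - etaR η _) = _
  rw [map_sub, etaR_map, map_ofNat]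

lemma g_half (hp2 : p ≠ 2) (D : CharData p) : (D.g : ZMod p) ^ ((p - 1) / 2) = -1 := by
  have htwo := hpf.out.two_le
  have h2 : ((D.g : ZMod p) ^ ((p - 1) / 2)) ^ 2 = 1 := by
    rw [← pow_mul, show (p - 1) / 2 * 2 = p - 1 by
      obtain ⟨k, hk⟩ := hpf.out.odd_of_ne_two hp2; omega]
    exact ZMod.pow_card_sub_one_eq_one D.g.ne_zero
  rcases (_root_.sq_eq_one_iff.1 h2) with h | h
  · exfalso
    have := orderOf_dvd_of_pow_eq_one h
    rw [orderOf_g] at this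
    have := Nat.le_of_dvd (by omega) this
    omega
  · exact h

/-- The log values. -/
noncomputable def ell (D : CharData p) (c : ℕ) : ℝ :=
  Real.log ‖1 - (ZMod.stdAddChar ((D.g : ZMod p) ^ c) : ℂ)‖

lemma norm_one_sub_neg (a : ZMod p) :
    ‖1 - (ZMod.stdAddChar (-a) : ℂ)‖ = ‖1 - (ZMod.stdAddChar a : ℂ)‖ := by
  rw [← Complex.norm_conj, map_sub, map_one, stdAddChar_conj, neg_neg]

lemma norm_one_sub_ne (a : ZMod p) (ha : a ≠ 0) : ‖1 - (ZMod.stdAddChar a : ℂ)‖ ≠ 0 := by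
  rw [norm_ne_zero_iff, sub_ne_zero]
  intro h
  apply ha
  apply ZMod.injective_stdAddChar
  rw [← h, AddChar.map_zero_eq_one]

lemma ell_periodic (hp2 : p ≠ 2) (D : CharData p) (c : ℕ) : ell D (c + (p - 1) / 2) = ell D c := by
  rw [ell, pow_add, g_half hp2, mul_neg_one, norm_one_sub_neg, ell]

lemma exists_family (hp2 : p ≠ 2) (hζ : IsPrimitiveRoot ζ p) {η : 𝓞 F}
    (hη : algebraMap F E η = ζ + ζ⁻¹) (htop : Algebra.adjoin ℚ {(η : F)} = ⊤)
    (D : CharData p) :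
    ∃ (u : Fin (Units.rank F) → (𝓞 F)ˣ) (e : {c : Fin ((p - 1) / 2) // (c : ℕ) ≠ 0} ≃ Fin (Units.rank F)),
      (∀ c : {c : Fin ((p - 1) / 2) // (c : ℕ) ≠ 0}, NG D η (c : Fin ((p - 1) / 2)) = NG D η 0 * u (e c)) ∧
      Units.regOfFamily u = ∏ j ∈ Finset.Ico 1 ((p - 1) / 2),
        ‖2 * ∑ c ∈ Finset.range ((p - 1) / 2), (ell D c : ℂ) * D.ψ D.g ^ (j * c)‖ := by
  classical
  have hpl := exists_places hp2 hζ hη htop D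
  have hfr := finrank_F hp2 hζ hη htop
  have hω := D.hω
  have hper := ell_periodic hp2 D
  obtain ⟨m, hm⟩ : ∃ m, (p - 1) / 2 = m + 1 := by
    refine ⟨(p - 1) / 2 - 1, ?_⟩
    have := hpf.out.two_le
    omega
  rw [hm] at hpl hω hfr hper ⊢
  obtain ⟨-, -, hmult, b, hb⟩ := hpl
  have hcard : Units.rank F = m := by
    have := Fintype.card_congr b
    rw [Fintype.card_fin] at this
    rw [Units.rank, ← this]; rfl
  have hU : ∀ c : ℕ, ∃ v : (𝓞 F)ˣ, NG D η c = NG D η 0 * v := by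
    intro c
    rw [NG_zero]
    obtain ⟨v, hv⟩ := N_assoc (E := E) hζ hη ((D.g : ZMod p) ^ c).val
      (by rw [ZMod.natCast_zmod_val]; exact pow_ne_zero _ D.g.ne_zero)
    exact ⟨v, hv.symm⟩
  choose U hU using hU
  have hne : ∀ c : Fin (m + 1), (c : ℕ) ≠ 0 ↔ b c ≠ b 0 := by
    intro c
    rw [not_iff_not, b.injective.eq_iff, Fin.ext_iff]; rfl
  let e1 : {c : Fin (m + 1) // (c : ℕ) ≠ 0} ≃ {w : InfinitePlace F // w ≠ b 0} :=
    b.subtypeEquiv hne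
  let e2 : {w : InfinitePlace F // w ≠ b 0} ≃ Fin (Units.rank F) :=
    Fintype.equivOfCardEq (by
      rw [Fintype.card_fin, Fintype.card_subtype_compl]; simp [Units.rank])
  let u : Fin (Units.rank F) → (𝓞 F)ˣ := fun i => U (b.symm (e2.symm i).1)
  have hu : ∀ c, u ((e1.trans e2) c) = U (c : Fin (m + 1)) := by
    intro c
    simp [u, e1]
  refine ⟨u, e1.trans e2, fun c => ?_, ?_⟩
  · rw [hu]; exact hU _
  have hNG : ∀ (c : Fin (m + 1)) (i : ℕ), Real.log (b c (NG D η i : F)) = 2 * ell D (i + c) := by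
    intro c i
    have := hb c ((D.g : ZMod p) ^ i).val
    rw [ZMod.natCast_zmod_val, ← pow_add] at this
    rw [ell]
    have hx : ((NG D η i : 𝓞 F) : F) = 2 - etaR (η : F) ((D.g : ZMod p) ^ i).val := by
      exact NG_coe D η i
    rw [hx, this, Real.log_pow]; norm_num
  have hNG0 : ∀ i, ((NG D η i : 𝓞 F) : F) ≠ 0 := by
    intro i h
    have := hb 0 ((D.g : ZMod p) ^ i).val
    have hx : ((NG D η i : 𝓞 F) : F) = 2 - etaR (η : F) ((D.g : ZMod p) ^ i).val := by
      exact NG_coe D η i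
    rw [← hx, h, map_zero, ZMod.natCast_zmod_val, ← pow_add] at this
    exact pow_ne_zero 2 (norm_one_sub_ne _ (pow_ne_zero _ D.g.ne_zero)) this.symm
  have hUlog : ∀ (c : Fin (m + 1)) (i : ℕ), Real.log (b c (U i : F)) = 2 * (ell D (i + c) - ell D c) := by
    intro c i
    have h1 := hNG c i
    have h0 := hNG c 0
    have := congrArg (fun x : 𝓞 F => (x : F)) (hU i)
    simp only [map_mul] at this
    rw [this, map_mul, Real.log_mul] at h1
    · rw [h0, zero_add] at h1
      linear_combination h1
    · exact (map_ne_zero _).2 (hNG0 0)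
    · exact (map_ne_zero _).2 (by simp)
  have hreg := Units.finrank_mul_regOfFamily_eq_det u (b 0) e2
  rw [← Matrix.det_submatrix_equiv_self b, det_circ m (D.ψ D.g) hω (ell D) hper, hfr] at hreg
  · push_cast at hreg
    exact mul_left_cancel₀ (by positivity) hreg
  · intro c
    simp [hmult]
  · intro i c hi
    have hi' : b i ≠ b 0 := fun h => hi (b.injective h)
    simp only [Matrix.submatrix_apply, Matrix.of_apply, dif_neg hi', hmult]
    have h2 : u (e2 ⟨b i, hi'⟩) = U (i : ℕ) := by simp [u]
    rw [h2, Nat.cast_one, one_mul]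
    exact hUlog c i
end setup

section setup
variable {p : ℕ} [hpf : Fact p.Prime] {F E : Type*} [Field F] [NumberField F] [Field E]
  [NumberField E] [Algebra F E] [hcyc : IsCyclotomicExtension {p} ℚ E] {ζ : E}

lemma norm_gauss (χ : DirichletCharacter ℂ p) (hχ : χ ≠ 1) :
    ‖gaussSum χ (ZMod.stdAddChar (N := p))‖ = √p := by
  have h1 := gaussSum_mul_gaussSum_eq_card (R' := ℂ) hχ (ZMod.isPrimitive_stdAddChar p)
  have h2 := star_gaussSum_eq χ (ZMod.stdAddChar (N := p))
  rw [← h2, ZMod.card] at h1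
  have h3 := congrArg norm h1
  rw [norm_mul, norm_star, Complex.norm_natCast] at h3
  rw [← h3, Real.sqrt_mul_self (norm_nonneg _)]

lemma sum_zmod_g (D : CharData p) (f : ZMod p → ℂ) (h0 : f 0 = 0) :
    ∑ a : ZMod p, f a = ∑ c ∈ Finset.range (p - 1), f ((D.g : ZMod p) ^ c) := by
  classical
  have himg : (Finset.univ : Finset (ZMod p)).erase 0 =
      (Finset.range (p - 1)).image (fun c => (D.g : ZMod p) ^ c) := by
    ext a
    simp only [Finset.mem_erase, Finset.mem_univ, and_true, Finset.mem_image, Finset.mem_range]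
    constructor
    · intro ha
      obtain ⟨k, hk⟩ := (mem_powers_iff_mem_zpowers).2 (D.hg (Units.mk0 a ha))
      have hk' : (D.g : ZMod p) ^ k = a := by
        have := congrArg Units.val hk
        simpa using this
      refine ⟨k % (p - 1), Nat.mod_lt _ (by have := hpf.out.two_le; omega), ?_⟩
      rw [← hk', ← orderOf_g D, pow_mod_orderOf]
    · rintro ⟨c, -, rfl⟩
      exact pow_ne_zero _ D.g.ne_zero
  rw [← Finset.sum_erase _ h0, himg, Finset.sum_image]
  intro i hi j hj h
  apply pow_injOn_Iio_orderOf (x := (D.g : ZMod p)) _ _ h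
  · rw [orderOf_g]; simpa using hi
  · rw [orderOf_g]; simpa using hj

lemma norm_L (hp2 : p ≠ 2) (D : CharData p) (j : ℕ) (hj : j ∈ Finset.Ico 1 ((p - 1) / 2)) :
    ‖DirichletCharacter.LFunction (D.ψ ^ j) 1‖ * √p =
      ‖2 * ∑ c ∈ Finset.range ((p - 1) / 2), (ell D c : ℂ) * D.ψ D.g ^ (j * c)‖ := by
  have hne := psi_pow_ne_one D hj
  have hj1 : 1 ≤ j := (Finset.mem_Ico.1 hj).1
  have heven : (D.ψ ^ j).Even := by
    rw [DirichletCharacter.Even, MulChar.pow_apply' _ (by omega), D.heven, one_pow]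
  have hA := congrArg norm (LFunction_one_gauss p (D.ψ ^ j) hne heven)
  rw [norm_mul, norm_gauss _ (inv_ne_one.2 hne), norm_neg] at hA
  rw [mul_comm, hA]
  have hconj : ∑ a : ZMod p, (D.ψ ^ j)⁻¹ a * ((Real.log ‖1 - (ZMod.stdAddChar a : ℂ)‖ : ℝ) : ℂ) =
      (starRingEnd ℂ) (∑ a : ZMod p, (D.ψ ^ j) a * ((Real.log ‖1 - (ZMod.stdAddChar a : ℂ)‖ : ℝ) : ℂ)) := by
    rw [map_sum]
    apply Finset.sum_congr rfl
    intro a _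
    rw [map_mul, Complex.conj_ofReal, ← MulChar.star_apply']
    rfl
  rw [hconj, Complex.norm_conj, sum_zmod_g D _ (by rw [MulChar.map_zero, zero_mul])]
  congr 1
  have e : p - 1 = (p - 1) / 2 + (p - 1) / 2 := by
    obtain ⟨k, hk⟩ := hpf.out.odd_of_ne_two hp2
    omega
  conv_lhs => rw [e]
  have key : ∀ c : ℕ, (D.ψ ^ j) ((D.g : ZMod p) ^ c) *
      ((Real.log ‖1 - (ZMod.stdAddChar ((D.g : ZMod p) ^ c) : ℂ)‖ : ℝ) : ℂ) =
      (ell D c : ℂ) * D.ψ D.g ^ (j * c) := by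
    intro c
    rw [map_pow, MulChar.pow_apply_coe, ← pow_mul, mul_comm]; rfl
  simp only [key]
  rw [Finset.sum_range_add, two_mul]
  congr 1
  apply Finset.sum_congr rfl
  intro c _
  rw [add_comm, ell_periodic hp2, mul_add, pow_add, mul_comm j ((p - 1) / 2),
    pow_mul _ ((p - 1) / 2), D.hω.pow_eq_one, one_pow, mul_one]

lemma index_formula (hp2 : p ≠ 2) (hζ : IsPrimitiveRoot ζ p) {η : 𝓞 F}
    (hη : algebraMap F E η = ζ + ζ⁻¹) (htop : Algebra.adjoin ℚ {(η : F)} = ⊤)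
    (D : CharData p) (u : Fin (Units.rank F) → (𝓞 F)ˣ)
    (hu : Units.regOfFamily u = ∏ j ∈ Finset.Ico 1 ((p - 1) / 2),
        ‖2 * ∑ c ∈ Finset.range ((p - 1) / 2), (ell D c : ℂ) * D.ψ D.g ^ (j * c)‖) :
    (Subgroup.closure (Set.range u) ⊔ (Units.torsion F)).index ^ 2 * (discr F).natAbs *
      (Units.torsionOrder F) ^ 2 = 4 ^ ((p - 1) / 2) * (classNumber F) ^ 2 * p ^ ((p - 1) / 2 - 1) := by
  have h1 := congrArg norm (residue_eq hp2 hζ hη htop D)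
  rw [norm_prod, Complex.norm_real, Real.norm_of_nonneg (dedekindZeta_residue_pos F).le] at h1
  have h2 : dedekindZeta_residue F * √p ^ ((p - 1) / 2 - 1) = Units.regOfFamily u := by
    rw [h1, hu, ← Finset.prod_congr rfl (norm_L hp2 D), Finset.prod_mul_distrib, Finset.prod_const,
      Nat.card_Ico]
  obtain ⟨hr, hc, -, -⟩ := exists_places hp2 hζ hη htop D
  rw [dedekindZeta_residue_def, hr, hc, pow_zero, mul_one] at h2
  have h3 := Units.regOfFamily_div_regulator u
  have hR := Units.regulator_ne_zero F
  rw [div_eq_iff hR] at h3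
  rw [h3] at h2
  set J := (Subgroup.closure (Set.range u) ⊔ (Units.torsion F)).index
  have hw : (Units.torsionOrder F : ℝ) ≠ 0 := by exact_mod_cast (Units.torsionOrder_pos F).ne'
  have hd : (0 : ℝ) < |(discr F : ℝ)| := abs_pos.2 (by exact_mod_cast discr_ne_zero F)
  have hd' : √|(discr F : ℝ)| ≠ 0 := (Real.sqrt_pos.2 hd).ne'
  rw [div_mul_eq_mul_div, div_eq_iff (mul_ne_zero hw hd')] at h2
  have h4 : (2 : ℝ) ^ ((p - 1) / 2) * classNumber F * √p ^ ((p - 1) / 2 - 1) =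
      J * (Units.torsionOrder F * √|(discr F : ℝ)|) := by
    apply mul_left_cancel₀ hR
    linear_combination h2
  have h5 := congrArg (· ^ 2) h4
  simp only [mul_pow, Real.sq_sqrt hd.le] at h5
  rw [← pow_mul, ← pow_mul, mul_comm _ 2, mul_comm _ 2, pow_mul, pow_mul, Real.sq_sqrt (by positivity)] at h5
  have h6 : |(discr F : ℝ)| = ((discr F).natAbs : ℝ) := by
    rw [Nat.cast_natAbs]; push_cast; rfl
  have h7 : ((J ^ 2 * (discr F).natAbs * (Units.torsionOrder F) ^ 2 : ℕ) : ℝ) =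
    ((4 ^ ((p - 1) / 2) * (classNumber F) ^ 2 * p ^ ((p - 1) / 2 - 1) : ℕ) : ℝ) := by
    push_cast
    norm_num at h5
    rw [← h6]
    linear_combination -h5
  exact_mod_cast h7

lemma pow_dvd_discr (hp2 : p ≠ 2) (hζ : IsPrimitiveRoot ζ p) {η : 𝓞 F}
    (hη : algebraMap F E η = ζ + ζ⁻¹) (htop : Algebra.adjoin ℚ {(η : F)} = ⊤) :
    p ^ ((p - 1) / 2 - 1) ∣ (discr F).natAbs := by
  obtain ⟨h1, h2, h3, -⟩ := primesAt_p hp2 hζ hη htop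
  have hpZ : Prime (p : ℤ) := Nat.prime_iff_prime_int.1 hpf.out
  have hmax : (Ideal.span {(p : ℤ)}).IsMaximal :=
    PrincipalIdealRing.isMaximal_of_irreducible hpZ.irreducible
  have := pow_sub_one_dvd_differentIdeal ℤ (p := Ideal.span {(p : ℤ)}) (Ideal.span {2 - η})
    ((p - 1) / 2) (by simpa using hpf.out.ne_zero)
    (by rw [h1, Ideal.map_span, Set.image_singleton]; simp)
  have h4 := Ideal.absNorm_dvd_absNorm_of_le (Ideal.le_of_dvd this)
  rw [map_pow, h2, NumberField.absNorm_differentIdeal F] at h4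
  exact h4

lemma index_coprime (hp2 : p ≠ 2) (hζ : IsPrimitiveRoot ζ p) {η : 𝓞 F}
    (hη : algebraMap F E η = ζ + ζ⁻¹) (htop : Algebra.adjoin ℚ {(η : F)} = ⊤)
    (hV : ¬ p ∣ classNumber F)
    (D : CharData p) (u : Fin (Units.rank F) → (𝓞 F)ˣ)
    (hu : Units.regOfFamily u = ∏ j ∈ Finset.Ico 1 ((p - 1) / 2),
        ‖2 * ∑ c ∈ Finset.range ((p - 1) / 2), (ell D c : ℂ) * D.ψ D.g ^ (j * c)‖) :
    ¬ p ∣ (Subgroup.closure (Set.range u) ⊔ (Units.torsion F)).index ∧ Units.IsMaxRank u := by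
  have h := index_formula hp2 hζ hη htop D u hu
  obtain ⟨d, hd⟩ := pow_dvd_discr hp2 hζ hη htop
  have hp := hpf.out
  set J := (Subgroup.closure (Set.range u) ⊔ (Units.torsion F)).index with hJ
  have hpp : p ^ ((p - 1) / 2 - 1) ≠ 0 := pow_ne_zero _ hp.ne_zero
  have h2 : J ^ 2 * d * (Units.torsionOrder F) ^ 2 = 4 ^ ((p - 1) / 2) * (classNumber F) ^ 2 := by
    apply Nat.eq_of_mul_eq_mul_right (Nat.pos_of_ne_zero hpp)
    rw [← h, hd]; ring
  have hcop : ¬ p ∣ J := by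
    intro hdvd
    have : p ∣ 4 ^ ((p - 1) / 2) * (classNumber F) ^ 2 := by
      rw [← h2, mul_assoc]
      exact Dvd.dvd.mul_right (dvd_pow hdvd two_ne_zero) _
    rcases hp.dvd_mul.1 this with h | h
    · have h4 := hp.dvd_of_dvd_pow h
      rw [show 4 = 2 ^ 2 by norm_num] at h4
      exact hp2 ((Nat.prime_dvd_prime_iff_eq hp Nat.prime_two).1 (hp.dvd_of_dvd_pow h4))
    · exact hV (hp.dvd_of_dvd_pow h)
  refine ⟨hcop, ?_⟩
  rw [← Units.regOfFamily_ne_zero_iff]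
  intro h0
  have h3 := Units.regOfFamily_div_regulator u
  rw [h0, zero_div] at h3
  apply hcop
  have : J = 0 := by exact_mod_cast h3.symm
  rw [this]; exact dvd_zero _
end setup

lemma units_indep {p : ℕ} (hp : p.Prime) {F : Type*} [Field F] [NumberField F]
    (u : Fin (Units.rank F) → (𝓞 F)ˣ) (hu : Units.IsMaxRank u)
    (hJ : ¬ p ∣ (Subgroup.closure (Set.range u) ⊔ (Units.torsion F)).index)
    (a : Fin (Units.rank F) → ℕ) (ε : (𝓞 F)ˣ) (h : ε ^ p = ∏ i, u i ^ a i) (i : Fin (Units.rank F)) :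
    p ∣ a i := by
  classical
  set H := Subgroup.closure (Set.range u) ⊔ (Units.torsion F) with hH
  have h1 : ε ^ H.index ∈ H := Subgroup.pow_index_mem H ε
  rw [hH, Subgroup.mem_sup] at h1
  obtain ⟨y, hy, t, ht, hyt⟩ := h1
  rw [← hH] at hyt
  obtain ⟨m, rfl⟩ := Subgroup.exists_of_mem_closure_range _ _ hy
  have hlt := Units.dirichletUnitTheorem.logEmbedding_eq_zero_iff.2 ht
  set L := fun x : (𝓞 F)ˣ => Units.logEmbedding F (Additive.ofMul x) with hL
  have hmul : ∀ x y, L (x * y) = L x + L y := fun x y => by simp [hL]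
  have hpow : ∀ x (n : ℕ), L (x ^ n) = (n : ℝ) • L x := fun x n => by
    simp only [hL, ofMul_pow, map_nsmul]
    exact (Nat.cast_smul_eq_nsmul ℝ n _).symm
  have hzpow : ∀ x (n : ℤ), L (x ^ n) = (n : ℝ) • L x := fun x n => by
    simp only [hL, ofMul_zpow, map_zsmul]
    exact (Int.cast_smul_eq_zsmul ℝ n _).symm
  have hprod : ∀ f : Fin (Units.rank F) → (𝓞 F)ˣ, L (∏ i, f i) = ∑ i, L (f i) := fun f => by
    simp only [hL, ofMul_prod, map_sum]
  have e1 := congrArg L h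
  have e2 := congrArg L hyt
  simp only [hmul, hpow, hzpow, hprod] at e1 e2
  rw [show L t = 0 from hlt, add_zero] at e2
  have e3 : ∑ i, ((H.index : ℝ) * a i - p * m i) • L (u i) = 0 := by
    have : ∑ i, ((H.index : ℝ) * a i - p * m i) • L (u i) =
      (H.index : ℝ) • ∑ i, (a i : ℝ) • L (u i) - (p : ℝ) • ∑ i, (m i : ℝ) • L (u i) := by
      rw [Finset.smul_sum, Finset.smul_sum, ← Finset.sum_sub_distrib]
      apply Finset.sum_congr rfl
      intro i _
      rw [sub_smul, mul_smul, mul_smul]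
    rw [this, ← e1, e2, smul_comm, sub_self]
  have e4 := Fintype.linearIndependent_iff.1 hu _ e3 i
  have e5 : (H.index : ℤ) * a i = p * m i := by
    have : (H.index : ℝ) * a i = p * m i := by linarith
    exact_mod_cast this
  have e6 : (p : ℤ) ∣ ((H.index * a i : ℕ) : ℤ) := by
    push_cast
    rw [e5]; exact dvd_mul_right _ _
  exact (hp.dvd_mul.1 (Int.natCast_dvd_natCast.1 e6)).resolve_left hJ

section setup
variable {p : ℕ} [hpf : Fact p.Prime] {F E : Type*} [Field F] [NumberField F] [Field E]
  [NumberField E] [Algebra F E] [hcyc : IsCyclotomicExtension {p} ℚ E] {ζ : E}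

lemma indep_NG (hp2 : p ≠ 2) (hζ : IsPrimitiveRoot ζ p) {η : 𝓞 F}
    (hη : algebraMap F E η = ζ + ζ⁻¹) (htop : Algebra.adjoin ℚ {(η : F)} = ⊤)
    (hV : ¬ p ∣ classNumber F) (D : CharData p) (b : Fin ((p - 1) / 2) → ℕ) (δ : 𝓞 F)
    (h : ∏ c : Fin ((p - 1) / 2), NG D η c ^ b c = δ ^ p) (c : Fin ((p - 1) / 2)) : p ∣ b c := by
  classical
  have hp := hpf.out
  obtain ⟨u, e, hue, hreg⟩ := exists_family hp2 hζ hη htop D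
  obtain ⟨hJ, hmax⟩ := index_coprime hp2 hζ hη htop hV D u hreg
  obtain ⟨-, hP, -, -⟩ := primesAt_p hp2 hζ hη htop
  rw [← NG_zero D η] at hP
  let v : Fin ((p - 1) / 2) → (𝓞 F)ˣ := fun c => if hc : (c : ℕ) ≠ 0 then u (e ⟨c, hc⟩) else 1
  have hv : ∀ c : Fin ((p - 1) / 2), NG D η c = NG D η 0 * v c := by
    intro c
    by_cases hc : (c : ℕ) ≠ 0
    · simp only [v, dif_pos hc]; exact hue ⟨c, hc⟩
    · simp only [v, dif_neg hc]; rw [not_not.1 hc]; simp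
  set B := ∑ c, b c with hB
  have h1 : NG D η 0 ^ B * ((∏ c, v c ^ b c : (𝓞 F)ˣ) : 𝓞 F) = δ ^ p := by
    rw [← h, hB, ← Finset.prod_pow_eq_pow_sum]
    push_cast
    rw [← Finset.prod_mul_distrib]
    apply Finset.prod_congr rfl
    intro c _
    rw [hv c, mul_pow]
  have h2 : p ^ B = (Ideal.absNorm (Ideal.span {δ})) ^ p := by
    rw [← map_pow, Ideal.span_singleton_pow, ← h1, Ideal.span_singleton_mul_right_unit (Units.isUnit _),
      ← Ideal.span_singleton_pow, map_pow, hP]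
  obtain ⟨k, -, hk⟩ := (Nat.dvd_prime_pow hp).1 (h2 ▸ dvd_pow_self _ hp.ne_zero :
    Ideal.absNorm (Ideal.span {δ}) ∣ p ^ B)
  rw [hk, ← pow_mul] at h2
  have hBk : B = k * p := Nat.pow_right_injective hp.two_le h2
  have hNG0 : NG D η 0 ≠ 0 := by
    intro h0
    rw [h0] at hP
    simp at hP
    exact hp.ne_zero hP.symm
  rw [hBk, pow_mul] at h1
  have hdvd : NG D η 0 ^ k ∣ δ := by
    have h3 : (NG D η 0 ^ k) ^ p ∣ δ ^ p := ⟨_, h1.symm⟩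
    exact (IsIntegrallyClosed.pow_dvd_pow_iff hp.ne_zero).1 h3
  obtain ⟨ε, rfl⟩ := hdvd
  rw [mul_pow] at h1
  have h4 := mul_left_cancel₀ (pow_ne_zero _ (pow_ne_zero _ hNG0)) h1
  have hεu : IsUnit ε := (isUnit_pow_iff hp.ne_zero).1 (h4 ▸ Units.isUnit _)
  obtain ⟨ε, rfl⟩ := hεu
  have h5 : ε ^ p = ∏ i, u i ^ (b (e.symm i)) := by
    have : ε ^ p = ∏ c, v c ^ b c := by
      apply Units.ext; rw [h4]; push_cast; rfl
    rw [this, ← e.prod_comp]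
    simp only [Equiv.symm_apply_apply]
    rw [← Fintype.prod_subtype_mul_prod_subtype (fun c : Fin ((p - 1) / 2) => (c : ℕ) ≠ 0)]
    rw [Finset.prod_eq_one (s := (Finset.univ : Finset {c : Fin ((p - 1) / 2) // ¬ (c : ℕ) ≠ 0})), mul_one]
    · apply Finset.prod_congr rfl
      intro c _
      simp only [v, dif_pos c.2]
    · intro c _
      simp only [v, dif_neg c.2, one_pow]
  have h6 := units_indep hp u hmax hJ _ ε h5
  have h7 : ∀ c : Fin ((p - 1) / 2), (c : ℕ) ≠ 0 → p ∣ b c := by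
    intro c hc
    have := h6 (e ⟨c, hc⟩)
    simpa using this
  by_cases hc : (c : ℕ) ≠ 0
  · exact h7 c hc
  · have : B = b c + ∑ c' ∈ Finset.univ.erase c, b c' := by
      rw [hB, Finset.add_sum_erase _ _ (Finset.mem_univ c)]
    have hd : p ∣ ∑ c' ∈ Finset.univ.erase c, b c' := by
      apply Finset.dvd_sum
      intro c' hc'
      apply h7
      intro h0
      exact (Finset.mem_erase.1 hc').1 (Fin.ext (h0.trans (not_not.1 hc).symm))
    exact (Nat.dvd_add_left hd).1 (this ▸ hBk ▸ dvd_mul_left _ _)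

lemma N_congr (hζ : IsPrimitiveRoot ζ p) {η : 𝓞 F}
    (hη : algebraMap F E η = ζ + ζ⁻¹) (i k : ℕ) (h : (i : ZMod p) = k ∨ (i : ZMod p) = -k) :
    2 - etaR η i = 2 - etaR η k := by
  apply FaithfulSMul.algebraMap_injective (𝓞 F) (𝓞 E)
  rw [N_map hζ hη, N_map hζ hη]
  rcases h with h | h
  · rw [zpow_congr hζ h, zpow_congr hζ.inv h]
  · have h1 : ((i + k : ℕ) : ZMod p) = (0 : ℕ) := by push_cast; rw [h]; ring
    have a1 := zpow_congr hζ h1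
    have a2 := zpow_congr hζ.inv h1
    rw [pow_zero, pow_add] at a1 a2
    have a3 : hζ.toInteger ^ k * hζ.inv.toInteger ^ k = 1 := by rw [← mul_pow, zw_one hζ, one_pow]
    have b1 : hζ.toInteger ^ i = hζ.inv.toInteger ^ k := by
      linear_combination hζ.inv.toInteger ^ k * a1 - hζ.toInteger ^ i * a3
    have b2 : hζ.inv.toInteger ^ i = hζ.toInteger ^ k := by
      linear_combination hζ.toInteger ^ k * a2 - hζ.inv.toInteger ^ i * a3
    rw [b1, b2, mul_comm]

lemma indep_F (hp2 : p ≠ 2) (hζ : IsPrimitiveRoot ζ p) {η : 𝓞 F}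
    (hη : algebraMap F E η = ζ + ζ⁻¹) (htop : Algebra.adjoin ℚ {(η : F)} = ⊤)
    (hV : ¬ p ∣ classNumber F) (b : ℕ → ℕ) (δ : F)
    (h : ∏ i ∈ Finset.Icc 1 ((p - 1) / 2), (2 - etaR (η : F) i) ^ b i = δ ^ p)
    (i : ℕ) (hi : i ∈ Finset.Icc 1 ((p - 1) / 2)) : p ∣ b i := by
  classical
  have hp := hpf.out
  obtain ⟨D⟩ := exists_charData p hp2
  let τ : Fin ((p - 1) / 2) → ℕ := fun c => (((D.g : ZMod p) ^ (c : ℕ)).valMinAbs).natAbs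
  have hτ : ∀ c : Fin ((p - 1) / 2), ((τ c : ℕ) : ZMod p) = (D.g : ZMod p) ^ (c : ℕ) ∨
      ((τ c : ℕ) : ZMod p) = - (D.g : ZMod p) ^ (c : ℕ) := by
    intro c
    have := ZMod.coe_valMinAbs ((D.g : ZMod p) ^ (c : ℕ))
    rcases Int.natAbs_eq (((D.g : ZMod p) ^ (c : ℕ)).valMinAbs) with h | h
    · left
      conv_rhs => rw [← this, h]
      simp [τ]
    · right
      conv_rhs => rw [← this, h]
      simp [τ]
  have hmem : ∀ c, τ c ∈ Finset.Icc 1 ((p - 1) / 2) := by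
    intro c
    rw [Finset.mem_Icc]
    constructor
    · rw [Nat.one_le_iff_ne_zero]
      intro h0
      have := hτ c
      rw [h0] at this
      have hne := pow_ne_zero (c : ℕ) D.g.ne_zero
      rcases this with h | h
      · exact hne (by simpa using h.symm)
      · exact hne (by simpa using h.symm)
    · have := ZMod.natAbs_valMinAbs_le ((D.g : ZMod p) ^ (c : ℕ))
      obtain ⟨k, hk⟩ := hp.odd_of_ne_two hp2
      simp only [τ]
      omega
  have hinj : Function.Injective τ := by
    intro c c' hcc
    apply Fin.ext
    apply g_half_inj hp2 D _ _ c.2 c'.2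
    have h1 := hτ c
    have h2 := hτ c'
    rw [hcc] at h1
    rcases h1 with h1 | h1 <;> rcases h2 with h2 | h2
    · left; rw [← h1, ← h2]
    · right; rw [← h1, h2]
    · right; rw [← h2, h1, neg_neg]
    · left; exact neg_injective (h1.symm.trans h2)
  have himg : Finset.univ.image τ = Finset.Icc 1 ((p - 1) / 2) := by
    apply Finset.eq_of_subset_of_card_le
    · intro x hx
      obtain ⟨c, -, rfl⟩ := Finset.mem_image.1 hx
      exact hmem c
    · rw [Finset.card_image_of_injective _ hinj]; simp
  have hN : ∀ c : Fin ((p - 1) / 2), 2 - etaR η (τ c) = NG D η c := by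
    intro c
    apply N_congr (E := E) hζ hη
    rw [ZMod.natCast_zmod_val]
    exact hτ c
  have hN' : ∀ c : Fin ((p - 1) / 2), 2 - etaR (η : F) (τ c) = (NG D η c : F) := by
    intro c
    rw [← hN]
    change _ = algebraMap (𝓞 F) F (2 - etaR η _)
    rw [map_sub, etaR_map, map_ofNat]
  rw [← himg, Finset.prod_image (fun x _ y _ hxy => hinj hxy)] at h
  simp only [hN'] at h
  have hintg : IsIntegral ℤ δ := by
    apply IsIntegral.of_pow hp.pos
    rw [← h]
    apply IsIntegral.prod
    intro c _
    exact (NG D η c).isIntegral_coe.pow _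
  obtain ⟨δ', hδ'⟩ : ∃ δ' : 𝓞 F, algebraMap (𝓞 F) F δ' = δ := ⟨⟨δ, hintg⟩, rfl⟩
  rw [← hδ'] at h
  have h' : ∏ c : Fin ((p - 1) / 2), NG D η c ^ b (τ c) = δ' ^ p := by
    apply FaithfulSMul.algebraMap_injective (𝓞 F) F
    rw [map_prod, map_pow]
    simp only [map_pow]
    exact h
  rw [← himg] at hi
  obtain ⟨c, -, rfl⟩ := Finset.mem_image.1 hi
  exact indep_NG hp2 hζ hη htop hV D (fun c => b (τ c)) _ h' c
end setup

section setup
variable {p : ℕ} [hpf : Fact p.Prime] {F E : Type*} [Field F] [NumberField F] [Field E]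
  [NumberField E] [Algebra F E] [hcyc : IsCyclotomicExtension {p} ℚ E] {ζ : E}

lemma indep_E (hp2 : p ≠ 2) (hζ : IsPrimitiveRoot ζ p) {η : 𝓞 F}
    (hη : algebraMap F E η = ζ + ζ⁻¹) (htop : Algebra.adjoin ℚ {(η : F)} = ⊤)
    (hV : ¬ p ∣ classNumber F) (b0 : ℕ) (b : ℕ → ℕ) (γ : E)
    (h : ζ ^ b0 * ∏ i ∈ Finset.Icc 1 ((p - 1) / 2), (1 - ζ⁻¹ ^ i) ^ b i = γ ^ p) :
    p ∣ b0 ∧ ∀ i ∈ Finset.Icc 1 ((p - 1) / 2), p ∣ b i := by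
  have hp := hpf.out
  have hζ0 : ζ ≠ 0 := hζ.ne_zero hp.ne_zero
  have hzz : ζ * ζ⁻¹ = 1 := mul_inv_cancel₀ hζ0
  obtain ⟨σ, hσ⟩ := exists_conjE hζ
  have hi : ∀ i ∈ Finset.Icc 1 ((p - 1) / 2), p ∣ b i := by
    have h1 : (γ * σ γ) ^ p = algebraMap F E (∏ i ∈ Finset.Icc 1 ((p - 1) / 2),
        (2 - etaR (η : F) i) ^ b i) := by
      rw [mul_pow, ← map_pow, ← h, map_mul, map_pow, hσ, map_prod, map_prod,
        mul_mul_mul_comm, ← mul_pow, hzz, one_pow, one_mul, ← Finset.prod_mul_distrib]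
      apply Finset.prod_congr rfl
      intro i _
      rw [map_pow, map_pow, ← mul_pow, map_sub, map_sub, map_one, map_pow, map_inv₀, hσ, inv_inv,
        etaR_map, hη, etaR_eq _ _ hzz, map_ofNat]
      congr 1
      have : ζ ^ i * ζ⁻¹ ^ i = 1 := by rw [← mul_pow, hzz, one_pow]
      linear_combination this
    have h2 := congrArg (Algebra.norm F) h1
    rw [map_pow, Algebra.norm_algebraMap, finrank_FE hp2 hζ hη htop, ← Finset.prod_pow] at h2
    simp only [← pow_mul] at h2
    intro i hi
    have := indep_F hp2 hζ hη htop hV (fun i => b i * 2) _ h2.symm i hi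
    rcases hp.dvd_mul.1 this with h | h
    · exact h
    · exact absurd ((Nat.prime_dvd_prime_iff_eq hp Nat.prime_two).1 h) hp2
  refine ⟨?_, hi⟩
  by_contra hb0
  have hne : ∀ i ∈ Finset.Icc 1 ((p - 1) / 2), (1 - ζ⁻¹ ^ i) ≠ 0 := by
    intro i hi h0
    rw [Finset.mem_Icc] at hi
    exact hζ.inv.pow_ne_one_of_pos_of_lt (by omega) (by have := hp.two_le; omega) (sub_eq_zero.1 h0).symm
  set θ := ∏ i ∈ Finset.Icc 1 ((p - 1) / 2), (1 - ζ⁻¹ ^ i) ^ (b i / p) with hθ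
  have hθ0 : θ ≠ 0 := Finset.prod_ne_zero_iff.2 (fun i hi => pow_ne_zero _ (hne i hi))
  have h3 : ∏ i ∈ Finset.Icc 1 ((p - 1) / 2), (1 - ζ⁻¹ ^ i) ^ b i = θ ^ p := by
    rw [hθ, ← Finset.prod_pow]
    apply Finset.prod_congr rfl
    intro i h
    rw [← pow_mul, Nat.div_mul_cancel (hi i h)]
  have h4 : (γ / θ) ^ p = ζ ^ b0 := by
    rw [div_pow, ← h, h3, mul_div_cancel_right₀ _ (pow_ne_zero _ hθ0)]
  have h5 : IsPrimitiveRoot (ζ ^ b0) p :=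
    hζ.pow_of_coprime b0 (Nat.Coprime.symm ((Nat.Prime.coprime_iff_not_dvd hp).2 hb0))
  have h6 : orderOf (γ / θ) = p ^ (1 + 1) := by
    apply orderOf_eq_prime_pow
    · rw [pow_one, h4]; exact h5.ne_one hp.one_lt
    · rw [pow_succ, pow_one, pow_mul, h4, h5.pow_eq_one]
  have h7 : IsPrimitiveRoot (γ / θ) (p ^ (1 + 1)) := by
    rw [← h6]; exact IsPrimitiveRoot.orderOf _
  have h8 := IsPrimitiveRoot.dvd_of_isCyclotomicExtension p h7 (pow_ne_zero _ hp.ne_zero)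
  rw [pow_succ, pow_one] at h8
  have := Nat.dvd_of_mul_dvd_mul_right hp.pos h8
  exact hp2 ((Nat.prime_dvd_prime_iff_eq hp Nat.prime_two).1 this)
end setup

lemma isIntegral_rat_closure : Algebra.IsIntegral ℚ (AlgebraicClosure ℚ) := by
  have h2 := (inferInstance : @Algebra.IsIntegral ℚ (AlgebraicClosure ℚ) _ _
    (AlgebraicClosure.instAlgebra ℚ))
  convert h2 using 1
  exact Subsingleton.elim _ _

lemma indep_closure {p : ℕ} (hp : p.Prime) (hp2 : p ≠ 2) {ζ : AlgebraicClosure ℚ}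
    (hζ : IsPrimitiveRoot ζ p)
    (hV : ¬ p ∣ Nat.card (ClassGroup (NumberField.RingOfIntegers
      (IntermediateField.adjoin ℚ {ζ + ζ⁻¹})))) (b0 : ℕ) (b : ℕ → ℕ) (γ : AlgebraicClosure ℚ)
    (hγ : γ ∈ IntermediateField.adjoin ℚ {ζ})
    (h : ζ ^ b0 * ∏ i ∈ Finset.Icc 1 ((p - 1) / 2), (1 - ζ⁻¹ ^ i) ^ b i = γ ^ p) :
    p ∣ b0 ∧ ∀ i ∈ Finset.Icc 1 ((p - 1) / 2), p ∣ b i := by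
  have : Fact p.Prime := ⟨hp⟩
  have : NeZero p := ⟨hp.ne_zero⟩
  have hζint : IsIntegral ℤ ζ := hζ.isIntegral hp.pos
  have hηint : IsIntegral ℤ (ζ + ζ⁻¹) := by
    refine hζint.add ?_
    exact hζ.inv.isIntegral hp.pos
  have hζQ : IsIntegral ℚ ζ := hζint.tower_top
  have hηQ : IsIntegral ℚ (ζ + ζ⁻¹) := hηint.tower_top
  have hfd1 : FiniteDimensional ℚ (IntermediateField.adjoin ℚ {ζ}) :=
    IntermediateField.adjoin.finiteDimensional hζQ
  have hfd2 : FiniteDimensional ℚ (IntermediateField.adjoin ℚ {ζ + ζ⁻¹}) :=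
    IntermediateField.adjoin.finiteDimensional hηQ
  have : NumberField (IntermediateField.adjoin ℚ {ζ}) := ⟨⟩
  have : NumberField (IntermediateField.adjoin ℚ {ζ + ζ⁻¹}) := ⟨⟩
  have hA : Algebra.IsIntegral ℚ (AlgebraicClosure ℚ) :=
    isIntegral_rat_closure
  have : IsCyclotomicExtension {p} ℚ (IntermediateField.adjoin ℚ {ζ}) :=
    hζ.intermediateField_adjoin_isCyclotomicExtension ℚ
  have hmem : ζ ∈ IntermediateField.adjoin ℚ {ζ} := IntermediateField.mem_adjoin_simple_self ℚ ζ
  have hle : IntermediateField.adjoin ℚ {ζ + ζ⁻¹} ≤ IntermediateField.adjoin ℚ {ζ} := by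
    rw [IntermediateField.adjoin_simple_le_iff]
    exact add_mem hmem (inv_mem hmem)
  let : Algebra (IntermediateField.adjoin ℚ {ζ + ζ⁻¹}) (IntermediateField.adjoin ℚ {ζ}) :=
    (IntermediateField.inclusion hle).toRingHom.toAlgebra
  let η0 : IntermediateField.adjoin ℚ {ζ + ζ⁻¹} :=
    ⟨ζ + ζ⁻¹, IntermediateField.mem_adjoin_simple_self ℚ _⟩
  have hη0 : IsIntegral ℤ η0 := by
    rw [← isIntegral_algebraMap_iff (B := AlgebraicClosure ℚ) Subtype.val_injective]
    exact hηint
  let η : 𝓞 (IntermediateField.adjoin ℚ {ζ + ζ⁻¹}) := ⟨η0, hη0⟩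
  have hz : IsPrimitiveRoot (⟨ζ, hmem⟩ : IntermediateField.adjoin ℚ {ζ}) p :=
    IsPrimitiveRoot.of_map_of_injective
      (f := algebraMap (IntermediateField.adjoin ℚ {ζ}) (AlgebraicClosure ℚ)) hζ
      Subtype.val_injective
  refine indep_E (F := IntermediateField.adjoin ℚ {ζ + ζ⁻¹}) (E := IntermediateField.adjoin ℚ {ζ})
    hp2 hz (η := η) ?_ ?_ ?_ b0 b ⟨γ, hγ⟩ ?_
  · apply Subtype.ext
    rfl
  · exact (IntermediateField.adjoin.powerBasis hηQ).adjoin_gen_eq_top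
  · rw [classNumber, ← Nat.card_eq_fintype_card]
    exact hV
  · apply Subtype.ext
    rw [SubmonoidClass.coe_pow]
    simp only
    rw [← h]
    push_cast
    rfl

lemma kummer_abstract {K L : Type*} [Field K] [Field L] [Algebra K L] [IsGalois K L]
    [FiniteDimensional K L] {p : ℕ} (hp : p.Prime) {z : L} (hz : IsPrimitiveRoot z p)
    (hzK : ∀ σ : L ≃ₐ[K] L, σ z = z) (m : ℕ) (ρ : ℕ → L) (a : ℕ → K)
    (ha : ∀ j < m, a j ≠ 0) (hρ : ∀ j < m, ρ j ^ p = algebraMap K L (a j))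
    (Φ : (L ≃ₐ[K] L) → (Fin m → ZMod p))
    (hΦ : ∀ (σ : L ≃ₐ[K] L) (j : Fin m), σ (ρ j) = z ^ (Φ σ j).val * ρ j)
    (hinj : ∀ σ τ : L ≃ₐ[K] L, (∀ j < m, σ (ρ j) = τ (ρ j)) → σ = τ)
    (hind : ∀ (d : ℕ → ℕ) (γ : K), ∏ i ∈ Finset.range m, a i ^ d i = γ ^ p →
      ∀ i < m, p ∣ d i) :
    (∀ σ τ : L ≃ₐ[K] L, Φ (σ * τ) = Φ σ + Φ τ) ∧ Function.Bijective Φ := by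
  have : Fact p.Prime := ⟨hp⟩
  have hρ0 : ∀ j < m, ρ j ≠ 0 := by
    intro j hj h0
    have h1 := hρ j hj
    rw [h0, zero_pow hp.ne_zero] at h1
    exact ha j hj ((map_eq_zero (algebraMap K L)).1 h1.symm)
  have hpowmod : ∀ u v : ℕ, z ^ u = z ^ v → (u : ZMod p) = v := by
    intro u v h
    have hmod : ∀ w : ℕ, z ^ (w % p) = z ^ w := fun w => by
      conv_lhs => rw [hz.eq_orderOf]
      exact pow_mod_orderOf z w
    refine (ZMod.natCast_eq_natCast_iff _ _ _).2 ?_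
    exact hz.pow_inj (Nat.mod_lt _ hp.pos) (Nat.mod_lt _ hp.pos) (by rw [hmod, hmod, h])
  have hhom : ∀ σ τ : L ≃ₐ[K] L, Φ (σ * τ) = Φ σ + Φ τ := by
    intro σ τ
    funext j
    have h1 := hΦ (σ * τ) j
    rw [AlgEquiv.mul_apply, hΦ τ j, map_mul, map_pow, hzK, hΦ σ j, ← mul_assoc, ← pow_add] at h1
    have h2 := hpowmod _ _ (mul_right_cancel₀ (hρ0 j j.2) h1)
    push_cast at h2
    simp only [ZMod.natCast_val, ZMod.cast_id', id_eq] at h2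
    rw [Pi.add_apply, ← h2, add_comm]
  refine ⟨hhom, ?_, ?_⟩
  · intro σ τ h
    apply hinj
    intro j hj
    have h1 := hΦ σ ⟨j, hj⟩
    have h2 := hΦ τ ⟨j, hj⟩
    rw [h1, h2, h]
  · have hone : Φ 1 = 0 := by
      have h1 := hhom 1 1
      rw [mul_one] at h1
      simpa using h1
    let S0 : AddSubgroup (Fin m → ZMod p) :=
      { carrier := Set.range Φ
        add_mem' := by
          rintro _ _ ⟨σ, rfl⟩ ⟨τ, rfl⟩
          exact ⟨σ * τ, hhom σ τ⟩
        zero_mem' := ⟨1, hone⟩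
        neg_mem' := by
          rintro _ ⟨σ, rfl⟩
          refine ⟨σ⁻¹, ?_⟩
          have h1 := hhom σ⁻¹ σ
          rw [inv_mul_cancel, hone] at h1
          exact eq_neg_of_add_eq_zero_left h1.symm }
    let S := AddSubgroup.toZModSubmodule p S0
    have hmemS : ∀ σ, Φ σ ∈ S := fun σ => ⟨σ, rfl⟩
    by_cases hS : S = ⊤
    · intro v
      have hv : v ∈ S := hS ▸ Submodule.mem_top
      exact hv
    · exfalso
      obtain ⟨f, hf0, hf⟩ := Submodule.exists_le_ker_of_lt_top S (lt_top_iff_ne_top.2 hS)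
      let c : Fin m → ZMod p := fun i => f fun j => if i = j then 1 else 0
      have hfc : ∀ v, f v = ∑ i, v i * c i := fun v => LinearMap.pi_apply_eq_sum_univ f v
      let d : ℕ → ℕ := fun i => if h : i < m then (c ⟨i, h⟩).val else 0
      have hd : ∀ i : Fin m, ((d i : ℕ) : ZMod p) = c i := by
        intro i
        simp only [d, i.2, dif_pos, Fin.eta, ZMod.natCast_val, ZMod.cast_id', id_eq]
      let y : L := ∏ i : Fin m, ρ i ^ d i
      have hy : ∀ σ : L ≃ₐ[K] L, σ y = y := by
        intro σ
        have h1 : σ y = z ^ (∑ i : Fin m, (Φ σ i).val * d i) * y := by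
          simp only [y, map_prod, map_pow, hΦ, mul_pow, Finset.prod_mul_distrib, ← pow_mul,
            Finset.prod_pow_eq_pow_sum]
        have h2 : p ∣ ∑ i : Fin m, (Φ σ i).val * d i := by
          rw [← ZMod.natCast_eq_zero_iff]
          push_cast
          have h3 : f (Φ σ) = 0 := hf (hmemS σ)
          rw [hfc] at h3
          rw [← h3]
          refine Finset.sum_congr rfl fun i _ => ?_
          rw [hd]
          simp
        rw [h1, (hz.pow_eq_one_iff_dvd _).2 h2, one_mul]
      obtain ⟨γ, hγ⟩ := (IsGalois.mem_range_algebraMap_iff_fixed y).2 hy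
      have h4 : ∏ i ∈ Finset.range m, a i ^ d i = γ ^ p := by
        apply (algebraMap K L).injective
        rw [map_pow, hγ, map_prod, Finset.prod_range]
        simp only [y]
        rw [← Finset.prod_pow]
        refine Finset.prod_congr rfl fun i _ => ?_
        rw [map_pow, ← hρ i i.2, pow_right_comm]
      have h5 := hind d γ h4
      apply hf0
      ext1 v
      apply LinearMap.ext
      intro x
      simp only [LinearMap.comp_apply]
      rw [hfc, LinearMap.zero_apply]
      refine Finset.sum_eq_zero fun i _ => ?_
      rw [← hd i, (ZMod.natCast_eq_zero_iff _ _).2 (h5 i i.2), mul_zero]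

end helpers

/-- Let `p` be an odd prime satisfying Vandiver's conjecture, `ζ` a primitive `p`-th root of
unity in `Q̄ = AlgebraicClosure ℚ`, `K = ℚ(ζ)`, and `L ⊆ Q̄` the splitting field over `K` of
`f_p(x) = 1 - (1 - x^p)^p`.  Choose `p`-th roots `ρ 0` of `ζ` and `ρ i` of `1 - ζ⁻ⁱ` for
`1 ≤ i ≤ (p-1)/2`, all lying in `L`.  The map
`Φ = κ(ζ) × ∏_{i=1}^{(p-1)/2} κ(1 - ζ^{-i}) : Gal(L/K) → (ℤ/pℤ)^((p+1)/2)`,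
defined by `σ (ρ j) = ζ^(Φ σ j) · ρ j`, is a group isomorphism (a bijective homomorphism
from the Galois group to the additive group `(ℤ/pℤ)^((p+1)/2)`). -/
theorem stmt_6 (p : ℕ) (hp : p.Prime) (hodd : Odd p)
    (ζ : AlgebraicClosure ℚ) (hζ : IsPrimitiveRoot ζ p)
    (hV : ¬ p ∣ Nat.card (ClassGroup (NumberField.RingOfIntegers
      (IntermediateField.adjoin ℚ {ζ + ζ⁻¹}))))
    (K : IntermediateField ℚ (AlgebraicClosure ℚ))
    (hK : K = IntermediateField.adjoin ℚ {ζ})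
    (L : IntermediateField K (AlgebraicClosure ℚ))
    (hL : L = IntermediateField.adjoin K
      {x : AlgebraicClosure ℚ | 1 - (1 - x ^ p) ^ p = 0})
    (ρ : ℕ → L)
    (hρ0 : ((ρ 0 : AlgebraicClosure ℚ)) ^ p = ζ)
    (hρ : ∀ i : ℕ, 1 ≤ i → i ≤ (p - 1) / 2 →
      ((ρ i : AlgebraicClosure ℚ)) ^ p = 1 - ζ⁻¹ ^ i)
    (Φ : (L ≃ₐ[K] L) → (Fin ((p + 1) / 2) → ZMod p))
    (hΦ : ∀ (σ : L ≃ₐ[K] L) (j : Fin ((p + 1) / 2)),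
      ((σ (ρ (j : ℕ)) : AlgebraicClosure ℚ)) =
        ζ ^ (Φ σ j).val * ((ρ (j : ℕ) : AlgebraicClosure ℚ))) :
    (∀ σ τ : L ≃ₐ[K] L, Φ (σ * τ) = Φ σ + Φ τ) ∧ Function.Bijective Φ := by
  have hp2 : p ≠ 2 := by rintro rfl; exact absurd hodd (by decide)
  have : NeZero p := ⟨hp.ne_zero⟩
  obtain ⟨n, hn⟩ := hodd
  have hn1 : (p - 1) / 2 = n := by omega
  have hm : (p + 1) / 2 = n + 1 := by omega
  have hζK : ζ ∈ K := by rw [hK]; exact IntermediateField.mem_adjoin_simple_self ℚ ζ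
  have hζ0 : ζ ≠ 0 := hζ.ne_zero hp.ne_zero
  let ζK : K := ⟨ζ, hζK⟩
  let zL : L := algebraMap K L ζK
  have hzLc : (zL : AlgebraicClosure ℚ) = ζ := rfl
  have hzL : IsPrimitiveRoot zL p :=
    IsPrimitiveRoot.of_map_of_injective (f := algebraMap L (AlgebraicClosure ℚ)) hζ
      Subtype.val_injective
  have hzfix : ∀ σ : L ≃ₐ[K] L, σ zL = zL := fun σ => σ.commutes ζK
  let a : ℕ → K := fun j => if j = 0 then ζK else 1 - ζK⁻¹ ^ j
  have hac : ∀ j, ((a j : K) : AlgebraicClosure ℚ) = if j = 0 then ζ else 1 - ζ⁻¹ ^ j := by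
    intro j
    by_cases hj : j = 0 <;> simp [a, hj, ζK]
  -- Galois property
  let f : Polynomial K := 1 - (1 - Polynomial.X ^ p) ^ p
  have hf0 : f ≠ 0 := by
    intro h
    have h1 := congrArg (Polynomial.eval 1) h
    simp [f, hp.ne_zero] at h1
  have hset : {x : AlgebraicClosure ℚ | 1 - (1 - x ^ p) ^ p = 0} =
      f.rootSet (AlgebraicClosure ℚ) := by
    ext x
    rw [Polynomial.mem_rootSet]
    simp [f, hf0]
  have hsplit : Polynomial.IsSplittingField K L f := by
    rw [hL, hset]
    exact IntermediateField.adjoin_rootSet_isSplittingField (IsAlgClosed.splits _)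
  have hfin : FiniteDimensional K L := Polynomial.IsSplittingField.finiteDimensional L f
  have hnormal : Normal K L := Normal.of_isSplittingField f
  have hgal : IsGalois K L := ⟨⟩
  refine kummer_abstract hp hzL hzfix ((p + 1) / 2) ρ a ?_ ?_ Φ ?_ ?_ ?_
  · intro j hj h0
    have h1 := congrArg (fun x : K => (x : AlgebraicClosure ℚ)) h0
    simp only [hac] at h1
    by_cases hj0 : j = 0
    · simp [hj0, hζ0] at h1
    · simp only [hj0, if_false, ZeroMemClass.coe_zero] at h1
      have h2 : ζ⁻¹ ^ j = 1 := (sub_eq_zero.1 h1).symm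
      have h3 := Nat.le_of_dvd (by omega) ((hζ.inv.pow_eq_one_iff_dvd j).1 h2)
      omega
  · intro j hj
    apply Subtype.ext
    change (ρ j : AlgebraicClosure ℚ) ^ p = ((a j : K) : AlgebraicClosure ℚ)
    rw [hac]
    by_cases hj0 : j = 0
    · simp [hj0, hρ0]
    · rw [if_neg hj0]
      exact hρ j (by omega) (by omega)
  · intro σ j
    apply Subtype.ext
    exact hΦ σ j
  · intro σ τ h
    have hext : ((IsScalarTower.toAlgHom K L (AlgebraicClosure ℚ)).comp σ.toAlgHom) =
        ((IsScalarTower.toAlgHom K L (AlgebraicClosure ℚ)).comp τ.toAlgHom) := by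
      refine IntermediateField.algHom_ext_of_eq_adjoin K hL ?_
      intro x hx
      have hxL : x ∈ L := by rw [hL]; exact IntermediateField.subset_adjoin _ _ hx
      suffices hs : σ ⟨x, hxL⟩ = τ ⟨x, hxL⟩ from congrArg Subtype.val hs
      suffices hs : ∃ (w : L), w ^ p = (⟨x, hxL⟩ : L) ^ p ∧ σ w = τ w by
        obtain ⟨w, hw1, hw2⟩ := hs
        by_cases hw0 : w = 0
        · have : (⟨x, hxL⟩ : L) = 0 := by
            rw [hw0, zero_pow hp.ne_zero] at hw1
            exact pow_eq_zero_iff hp.ne_zero |>.1 hw1.symm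
          rw [this, map_zero, map_zero]
        · have h1 : ((⟨x, hxL⟩ : L) / w) ^ p = 1 := by
            rw [div_pow, hw1, div_self]
            rw [← hw1]
            exact pow_ne_zero _ hw0
          obtain ⟨i, -, hi⟩ := hzL.eq_pow_of_pow_eq_one h1
          have h2 : (⟨x, hxL⟩ : L) = zL ^ i * w := by
            rw [hi, div_mul_cancel₀ _ hw0]
          rw [h2, map_mul, map_mul, map_pow, map_pow, hzfix, hzfix, hw2]
      have hx' : (1 - x ^ p) ^ p = 1 := by
        have h1 : 1 - (1 - x ^ p) ^ p = 0 := hx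
        exact (sub_eq_zero.1 h1).symm
      obtain ⟨j, hj, hjx⟩ := hζ.eq_pow_of_pow_eq_one hx'
      have hxp : x ^ p = 1 - ζ ^ j := by rw [hjx]; ring
      by_cases hj0 : j = 0
      · refine ⟨0, ?_, by simp⟩
        apply Subtype.ext
        change (0 : AlgebraicClosure ℚ) ^ p = x ^ p
        rw [hxp, hj0, pow_zero, sub_self, zero_pow hp.ne_zero]
      · by_cases hjn : j ≤ n
        · refine ⟨-(ρ 0 ^ j * ρ j), ?_, ?_⟩
          · apply Subtype.ext
            change (-((ρ 0 : AlgebraicClosure ℚ) ^ j * (ρ j : AlgebraicClosure ℚ))) ^ p = x ^ p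
            rw [Odd.neg_pow ⟨n, hn⟩, mul_pow, pow_right_comm, hρ0,
              hρ j (by omega) (by omega), hxp, mul_sub, ← mul_pow, mul_inv_cancel₀ hζ0]
            ring
          · simp only [map_neg, map_mul, map_pow]
            rw [h 0 (by omega), h j (by omega)]
        · refine ⟨ρ (p - j), ?_, h _ (by omega)⟩
          apply Subtype.ext
          change (ρ (p - j) : AlgebraicClosure ℚ) ^ p = x ^ p
          rw [hρ (p - j) (by omega) (by omega), hxp]
          congr 1
          rw [inv_pow]
          refine inv_eq_of_mul_eq_one_left ?_
          rw [← pow_add, Nat.add_sub_cancel' hj.le, hζ.pow_eq_one]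
    ext x
    exact congrArg (fun g => g x) hext
  · intro d γ h
    have h1 := congrArg (fun x : K => (x : AlgebraicClosure ℚ)) h
    have hγ : (γ : AlgebraicClosure ℚ) ∈ IntermediateField.adjoin ℚ {ζ} := by
      rw [← hK]; exact γ.2
    have hI : Finset.Icc 1 n = Finset.Ico 1 (n + 1) := by
      ext i; simp only [Finset.mem_Icc, Finset.mem_Ico]; omega
    have h2 := indep_closure hp hp2 hζ hV (d 0) d γ hγ (by
      rw [hn1, hI]
      simp only [SubmonoidClass.coe_pow] at h1
      rw [← h1, hm, Finset.range_eq_Ico, Finset.prod_eq_prod_Ico_succ_bot (Nat.succ_pos n)]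
      push_cast
      rw [hac 0, if_pos rfl]
      congr 1
      refine Finset.prod_congr rfl fun i hi => ?_
      rw [hac i, if_neg (by have := Finset.mem_Ico.1 hi; omega)])
    intro i hi
    by_cases hi0 : i = 0
    · rw [hi0]; exact h2.1
    · exact h2.2 i (Finset.mem_Icc.2 ⟨by omega, by omega⟩)
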